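/- Let M be the L₀-structure described in the context, let M₀ be its reduct to the sublanguage {E, F₁, F₂, Q} (i.e., forgetting the relations E_n), and let T₀ = Th(M₀). Then T₀,aut has a model completion T₀^mc_aut, and every completion of T₀^mc_aut is unstable. -/

import Mathlib

namespace FirstOrder

open Language Structure

namespace ShelahE34

universe u v w

/-- The index type for the function symbols of the language consisting of a single
unary function symbol `σ`. -/
inductive SigmaFunc : ℕ → Type
  | sigma : SigmaFunc 1

/-- The language consisting of a single unary function symbol `σ`. -/
def sigmaLang : Language.{0, 0} :=
  ⟨SigmaFunc, fun _ => Empty⟩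

/-- `L⁺`: the language `L` expanded by one new unary function symbol `σ`. -/
abbrev LPlus (L : Language.{u, v}) : Language :=
  L.sum sigmaLang

/-- The new unary function symbol `σ` of `L⁺`. -/
def sigmaSymb (L : Language.{u, v}) : (LPlus L).Functions 1 :=
  Sum.inr SigmaFunc.sigma

/-- Application of the symbol `σ` to a term of `L⁺`. -/
def sigmaTerm {L : Language.{u, v}} {α : Type w} (t : (LPlus L).Term α) : (LPlus L).Term α :=
  Functions.apply₁ (sigmaSymb L) t

/-- The interpretation of the symbol `σ` in an `L⁺`-structure, as a function. -/
def sigmaMap (L : Language.{u, v}) (N : Type w) [(LPlus L).Structure N] : N → N :=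
  fun x => funMap (sigmaSymb L) ![x]

/-- The sentence `(∀x)(∀y)(σ(x) = σ(y) → x = y)`. -/
def sigmaInj (L : Language.{u, v}) : (LPlus L).Sentence :=
  ∀' ∀' ((sigmaTerm (&0) =' sigmaTerm (&1)) ⟹ ((&0) =' (&1)))

/-- The sentence `(∀y)(∃x)(σ(x) = y)`. -/
def sigmaSurj (L : Language.{u, v}) : (LPlus L).Sentence :=
  ∀' ∃' (sigmaTerm (&1) =' (&0))

/-- The sentence `(∀x̄)(F(σ(x̄)) = σ(F(x̄)))` for a function symbol `F` of `L`. -/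
def funCommSentence (L : Language.{u, v}) {n : ℕ} (F : L.Functions n) : (LPlus L).Sentence :=
  BoundedFormula.alls
    (sigmaTerm (Term.func (Sum.inl F : (LPlus L).Functions n) fun i => Term.var (Sum.inr i)) ='
      Term.func (Sum.inl F : (LPlus L).Functions n) fun i => sigmaTerm (Term.var (Sum.inr i)))

/-- The sentence `(∀x̄)(R(x̄) ↔ R(σ(x̄)))` for a relation symbol `R` of `L`. -/
def relPresSentence (L : Language.{u, v}) {n : ℕ} (R : L.Relations n) : (LPlus L).Sentence :=
  BoundedFormula.alls
    ((Relations.boundedFormula (Sum.inl R : (LPlus L).Relations n)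
        fun i => Term.var (Sum.inr i)) ⇔
      Relations.boundedFormula (Sum.inl R : (LPlus L).Relations n)
        fun i => sigmaTerm (Term.var (Sum.inr i)))

/-- `T_aut`: the `L⁺`-theory consisting of `T` together with the sentences asserting that `σ`
is an automorphism. -/
def Taut {L : Language.{u, v}} (T : L.Theory) : (LPlus L).Theory :=
  (LHom.sumInl : L →ᴸ LPlus L).onTheory T ∪ {sigmaInj L, sigmaSurj L} ∪
    {φ | ∃ (n : ℕ) (F : L.Functions n), φ = funCommSentence L F} ∪
    {φ | ∃ (n : ℕ) (R : L.Relations n), φ = relPresSentence L R}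

/-- A theory is complete and consistent if it is satisfiable and semantically decides every
sentence. -/
def SemComplete {L' : Language.{u, v}} (U : L'.Theory) : Prop :=
  U.IsSatisfiable ∧ ∀ φ : L'.Sentence, U ⊨ᵇ φ ∨ U ⊨ᵇ ∼φ

/-- A completion of a theory `S`: a complete consistent theory in the same language
containing `S`. -/
def IsCompletionOf {L' : Language.{u, v}} (S U : L'.Theory) : Prop :=
  S ⊆ U ∧ SemComplete U

/-- The atomic diagram of a structure `M`: all atomic and negated atomic sentences with
constants from `M` that hold in `M`. -/
def atomicDiagram (L' : Language.{u, v}) (M : Type w) [L'.Structure M] : (L'[[M]]).Theory :=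
  {φ | (φ.IsAtomic ∨ ∃ ψ : (L'[[M]]).Sentence, ψ.IsAtomic ∧ φ = ∼ψ) ∧ M ⊨ φ}

/-- `Tstar` is a model completion of `S`: it contains `S`, every model of `S` embeds into a
model of `Tstar`, and for every model `M` of `S`, `Tstar` together with the atomic diagram of
`M` is a complete consistent theory. -/
def IsModelCompletion.{u', v', w'} {L' : Language.{u', v'}} (S Tstar : L'.Theory) : Prop :=
  S ⊆ Tstar ∧
    (∀ M : Theory.ModelType.{u', v', w'} S, ∃ N : Theory.ModelType.{u', v', w'} Tstar,
      Nonempty (M ↪[L'] N)) ∧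
    ∀ M : Theory.ModelType.{u', v', w'} S,
      SemComplete ((L'.lhomWithConstants M).onTheory Tstar ∪ atomicDiagram L' M)

/-- A formula has the order property with respect to a theory `S` if in some model of `S`
there are tuples `(ā_i)` and `(b̄_j)` such that `φ(ā_i, b̄_j)` holds iff `i < j`. -/
def HasOrderProperty.{u', v', w'} {L' : Language.{u', v'}} (S : L'.Theory) : Prop :=
  ∃ (nx ny : ℕ) (φ : L'.Formula (Fin nx ⊕ Fin ny)) (N : Theory.ModelType.{u', v', w'} S)
    (a : ℕ → Fin nx → N) (b : ℕ → Fin ny → N),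
    ∀ i j : ℕ, φ.Realize (Sum.elim (a i) (b j)) ↔ i < j

/-- A theory is stable if no formula has the order property with respect to it. -/
def IsStableTheory.{u', v', w'} {L' : Language.{u', v'}} (S : L'.Theory) : Prop :=
  ¬ HasOrderProperty.{u', v', w'} S

/-- The function symbols of the language `L₀`: two unary function symbols `F₁` and `F₂`. -/
inductive L0Func : ℕ → Type
  | F₁ : L0Func 1
  | F₂ : L0Func 1

/-- The relation symbols of the language `L₀`: a unary symbol `Q`, a binary symbol `E` and
binary symbols `Eₙ` for each `n ∈ ℕ`. -/
inductive L0Rel : ℕ → Type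
  | Q : L0Rel 1
  | E : L0Rel 2
  | En : ℕ → L0Rel 2

/-- The language `L₀`. -/
def L0 : Language.{0, 0} :=
  ⟨L0Func, L0Rel⟩

/-- The universe of the structure `M`: quadruples `(η, k, n, ℓ)` with `η ∈ 2^ℕ`,
`k, n ∈ ℕ`, `ℓ ∈ {0, 1}` (as a Boolean) and `ℓ = 0` whenever `k = n`. -/
structure MPoint where
  eta : ℕ → Bool
  k : ℕ
  n : ℕ
  l : Bool
  cond : k = n → l = false

instance : Nonempty MPoint :=
  ⟨⟨fun _ => false, 0, 0, false, fun _ => rfl⟩⟩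

/-- The `L₀`-structure `M`. -/
instance L0StructureMPoint : L0.Structure MPoint where
  funMap {m} f x :=
    match f, x with
    | .F₁, x => ⟨(x 0).eta, (x 0).k, (x 0).k, false, fun _ => rfl⟩
    | .F₂, x => ⟨(x 0).eta, (x 0).n, (x 0).n, false, fun _ => rfl⟩
  RelMap {m} r x :=
    match r, x with
    | .Q, x => (x 0).k = (x 0).n
    | .E, x => (x 0).eta = (x 1).eta
    | .En n, x => ∀ i < n, (x 0).eta i = (x 1).eta i

/-- The relation symbols of the sublanguage `{E, F₁, F₂, Q}` of `L₀`. -/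
inductive L2Rel : ℕ → Type
  | Q : L2Rel 1
  | E : L2Rel 2

/-- The sublanguage `{E, F₁, F₂, Q}` of `L₀` (forgetting the relations `Eₙ`). -/
def L2 : Language.{0, 0} :=
  ⟨L0Func, L2Rel⟩

/-- The inclusion of the sublanguage `L₂ = {E, F₁, F₂, Q}` into `L₀`. -/
def L2toL0 : L2 →ᴸ L0 :=
  ⟨fun _ f => f, fun _ r =>
    match r with
    | .Q => L0Rel.Q
    | .E => L0Rel.E⟩

/-- `M₀`: the reduct of `M` to the sublanguage `{E, F₁, F₂, Q}`. -/
instance L2StructureMPoint : L2.Structure MPoint :=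
  L2toL0.reduct MPoint


/-- Abstract systems: the basic theory together with an automorphism. -/
structure Sys (N : Type u) where
  E : N → N → Prop
  F : Bool → N → N
  s : Equiv.Perm N
  refl : ∀ x, E x x
  symm : ∀ {x y}, E x y → E y x
  trans : ∀ {x y z}, E x y → E y z → E x z
  FE : ∀ i x, E (F i x) x
  FF : ∀ i j x, F i (F j x) = F j x
  Finj : ∀ x, F false x = F true x → F false x = x
  fib : ∀ a b, F false a = a → F false b = b → E a b → a ≠ b →
    ∃ x y, x ≠ y ∧ F false x = a ∧ F true x = b ∧ F false y = a ∧ F true y = b ∧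
      ∀ z, F false z = a → F true z = b → z = x ∨ z = y
  sE : ∀ {x y}, E (s x) (s y) ↔ E x y
  sF : ∀ i x, F i (s x) = s (F i x)

namespace Sys
variable {N : Type u} (S : Sys N)

def Q (x : N) : Prop := S.F false x = x

def P (t : ℤ) (a b : N) : Prop :=
  ∃ x, S.F false x ≠ x ∧ S.F false x = a ∧ S.F true x = b ∧ (S.s ^ t) x = x

theorem comm {x y : N} : S.E x y ↔ S.E y x := ⟨S.symm, S.symm⟩

theorem congr {x x' y y' : N} (h : S.E x x') (h' : S.E y y') : S.E x y ↔ S.E x' y' :=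
  ⟨fun k => S.trans (S.symm h) (S.trans k h'), fun k => S.trans h (S.trans k (S.symm h'))⟩

theorem nF (i : Bool) (n : ℕ) (x : N) : S.F i ((S.s ^ n) x) = (S.s ^ n) (S.F i x) := by
  induction n with
  | zero => simp
  | succ n ih => simp only [pow_succ', Equiv.Perm.mul_apply, S.sF, ih]

theorem zF (i : Bool) (z : ℤ) (x : N) : S.F i ((S.s ^ z) x) = (S.s ^ z) (S.F i x) := by
  obtain ⟨n, rfl | rfl⟩ := z.eq_nat_or_neg
  · simpa using S.nF i n x
  · have := S.nF i n ((S.s ^ (-(n:ℤ))) x)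
    have h2 : (S.s ^ n) ((S.s ^ (-(n:ℤ))) x) = x := by
      simp
    rw [h2] at this
    rw [this]; simp

theorem nE (n : ℕ) {x y : N} : S.E ((S.s ^ n) x) ((S.s ^ n) y) ↔ S.E x y := by
  induction n with
  | zero => simp
  | succ n ih => simp only [pow_succ', Equiv.Perm.mul_apply, S.sE, ih]

theorem zE (z : ℤ) {x y : N} : S.E ((S.s ^ z) x) ((S.s ^ z) y) ↔ S.E x y := by
  obtain ⟨n, rfl | rfl⟩ := z.eq_nat_or_neg
  · simpa using S.nE n
  · rw [← S.nE n]; simp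

theorem zadd (z w : ℤ) (x : N) : (S.s ^ (z + w)) x = (S.s ^ z) ((S.s ^ w) x) := by
  rw [zpow_add]; rfl

theorem zE' (z w : ℤ) {x y : N} :
    S.E ((S.s ^ z) x) ((S.s ^ w) y) ↔ S.E ((S.s ^ (z - w)) x) y := by
  rw [← S.zE (-w), ← S.zadd, ← S.zadd]; simp [sub_eq_neg_add]

theorem zEq (z w : ℤ) {x y : N} :
    (S.s ^ z) x = (S.s ^ w) y ↔ (S.s ^ (z - w)) x = y := by
  rw [← (S.s ^ (-w)).injective.eq_iff, ← S.zadd, ← S.zadd]; simp [sub_eq_neg_add]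

theorem QF (i : Bool) (x : N) : S.Q (S.F i x) := S.FF _ _ _

theorem Q.F {x : N} {S : Sys N} (h : S.Q x) (i : Bool) : S.F i x = x := by
  have := S.FF i false x
  rwa [h] at this

theorem zQ (z : ℤ) {x : N} : S.Q ((S.s ^ z) x) ↔ S.Q x := by
  simp [Q, S.zF]

theorem P_prop {S : Sys N} {t : ℤ} {a b : N} (h : S.P t a b) :
    S.Q a ∧ S.Q b ∧ S.E a b ∧ a ≠ b ∧ (S.s ^ t) a = a ∧ (S.s ^ t) b = b := by
  obtain ⟨x, hx, rfl, rfl, h⟩ := h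
  refine ⟨S.QF _ _, S.QF _ _, S.trans (S.FE _ _) (S.symm (S.FE _ _)), fun hh => hx (S.Finj _ hh), ?_, ?_⟩
  · rw [← S.zF, h]
  · rw [← S.zF, h]

theorem P_shift' {t z : ℤ} {a b : N} (h : S.P t a b) : S.P t ((S.s ^ z) a) ((S.s ^ z) b) := by
  obtain ⟨x, hx, rfl, rfl, h⟩ := h
  refine ⟨(S.s ^ z) x, ?_, S.zF _ _ _, S.zF _ _ _, ?_⟩
  · rw [S.zF]; exact fun h => hx ((S.s ^ z).injective h)
  · rw [← S.zadd, add_comm, S.zadd, h]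

theorem P_shift (t z : ℤ) {a b : N} : S.P t ((S.s ^ z) a) ((S.s ^ z) b) ↔ S.P t a b := by
  refine ⟨fun h => ?_, S.P_shift'⟩
  have := S.P_shift' (z := -z) h
  simpa using this

theorem P_zz (t z w : ℤ) {a b : N} :
    S.P t ((S.s ^ z) a) ((S.s ^ w) b) ↔ S.P t ((S.s ^ (z - w)) a) b := by
  rw [← S.P_shift t (-w), ← S.zadd, ← S.zadd]; simp [sub_eq_neg_add]

theorem P_zz' (t z w : ℤ) {a b : N} :
    S.P t ((S.s ^ z) a) ((S.s ^ w) b) ↔ S.P t a ((S.s ^ (w - z)) b) := by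
  rw [← S.P_shift t (-z), ← S.zadd, ← S.zadd]; simp [sub_eq_neg_add]

theorem fib2 {x z w : N} (hx : ¬ S.Q x) (hz : ∀ i, S.F i z = S.F i x) (hw : ∀ i, S.F i w = S.F i x)
    (hzx : z ≠ x) (hwx : w ≠ x) : z = w := by
  obtain ⟨p, q, hpq, -, -, -, -, h⟩ := S.fib (S.F false x) (S.F true x) (S.QF _ _) (S.QF _ _)
    (S.trans (S.FE _ _) (S.symm (S.FE _ _))) (fun hh => hx (S.Finj _ hh))
  have h1 := h x rfl rfl
  have h2 := h z (hz _) (hz _)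
  have h3 := h w (hw _) (hw _)
  grind

theorem fibx {a b : N} (ha : S.Q a) (hb : S.Q b) (hE : S.E a b) (hab : a ≠ b) :
    ∃ x y, x ≠ y ∧ ¬ S.Q x ∧ ¬ S.Q y ∧ (∀ i, S.F i y = S.F i x) ∧ S.F false x = a ∧ S.F true x = b := by
  obtain ⟨x, y, hxy, h1, h2, h3, h4, -⟩ := S.fib a b ha hb hE hab
  refine ⟨x, y, hxy, ?_, ?_, ?_, h1, h2⟩
  · intro hx
    exact hab (by rw [← h1, ← h2, hx.F, hx.F])
  · intro hx
    exact hab (by rw [← h3, ← h4, hx.F, hx.F])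
  · intro i; cases i <;> simp [*]

theorem P_all {x : N} (hx : ¬ S.Q x) (t : ℤ) :
    (S.s ^ t) x = x ↔ S.P t (S.F false x) (S.F true x) := by
  refine ⟨fun h => ⟨x, hx, rfl, rfl, h⟩, ?_⟩
  rintro ⟨y, hy, h1, h2, h⟩
  by_contra hne
  have hyx : y ≠ x := by rintro rfl; exact hne h
  have hF : ∀ i, S.F i y = S.F i x := by intro i; cases i <;> assumption
  have := S.fib2 (z := y) (w := (S.s ^ t) x) hx hF (by
    intro i; rw [S.zF, ← hF, ← S.zF, h]) hyx hne
  rw [← h] at this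
  exact hyx ((S.s ^ t).injective this)

theorem P_zero {a b : N} : S.P 0 a b ↔ S.Q a ∧ S.Q b ∧ S.E a b ∧ a ≠ b := by
  constructor
  · intro h
    obtain ⟨h1, h2, h3, h4, -⟩ := P_prop h
    exact ⟨h1, h2, h3, h4⟩
  · rintro ⟨h1, h2, h3, h4⟩
    obtain ⟨x, y, -, hx, -, -, h5, h6⟩ := S.fibx h1 h2 h3 h4
    exact ⟨x, hx, h5, h6, by simp⟩

theorem zmul_fix {x : N} {t : ℤ} (h : (S.s ^ t) x = x) (m : ℤ) : (S.s ^ (t * m)) x = x := by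
  rw [zpow_mul]
  exact Function.IsFixedPt.perm_zpow (e := S.s ^ t) h m

theorem P_mul {a b : N} (ha : S.Q a) (hb : S.Q b) (hE : S.E a b) (hab : a ≠ b) {t : ℤ}
    (hta : (S.s ^ t) a = a) (htb : (S.s ^ t) b = b) (m : ℤ) :
    S.P (t * m) a b ↔ S.P t a b ∨ Even m := by
  obtain ⟨x, y, hxy, hx, hy, hyx, rfl, rfl⟩ := S.fibx ha hb hE hab
  rw [← S.P_all hx, ← S.P_all hx]
  by_cases h : (S.s ^ t) x = x
  · simp [h, S.zmul_fix h]
  · have h1 : (S.s ^ t) x = y := S.fib2 (x := x) hx (by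
      intro i; rw [S.zF]; cases i <;> assumption) hyx h (Ne.symm hxy)
    have h2 : (S.s ^ t) y = x := by
      apply S.fib2 (x := y) hy _ (fun i => (hyx i).symm) _ hxy
      · intro i; rw [S.zF, hyx]; cases i <;> assumption
      · intro h3; exact hxy ((S.s ^ t).injective (h1.trans h3.symm))
    have h3 : (S.s ^ (t * 2)) x = x := by
      rw [mul_two, S.zadd, h1, h2]
    simp only [h, false_or]
    constructor
    · intro h4
      by_contra hodd
      rw [Int.not_even_iff_odd] at hodd
      obtain ⟨k, rfl⟩ := hodd
      rw [mul_add, add_comm, S.zadd, ← mul_assoc, S.zmul_fix h3, mul_one] at h4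
      exact h h4
    · rintro ⟨k, rfl⟩
      rw [← two_mul, ← mul_assoc, S.zmul_fix h3]

end Sys

def PN {N : Type u} (F : Bool → N → N) (σ : N → N) (t : ℕ) (a b : N) : Prop :=
  ∃ x, F false x ≠ x ∧ F false x = a ∧ F true x = b ∧ σ^[t] x = x

theorem Sys.PN_iff {N : Type u} (S : Sys N) (t : ℕ) (a b : N) : PN S.F S.s t a b ↔ S.P t a b := by
  simp [PN, Sys.P, Equiv.Perm.iterate_eq_pow]

/-- Genericity up to level `n`. -/
structure Gen {N : Type u} (E : N → N → Prop) (F : Bool → N → N) (σ : N → N) (n : ℕ) : Prop where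
  g1 : ∀ r, 0 < r → r ≤ n + 1 → ∀ (k : ℕ) (v : Fin k → N), ∃ x, E (σ^[r] x) x ∧
    (∀ i < r, 0 < i → ¬ E (σ^[i] x) x) ∧ ∀ i, ¬ E x (v i)
  g2 : ∀ r, 0 < r → r ≤ n → ∀ (k : ℕ) (e f : Fin k → Prop) (w : ℕ → Prop) (x : N) (v : Fin k → N),
    E (σ^[r] x) x →
    (∀ i j, ∀ q ≤ n, σ^[r * q] (v i) = v j → (e i ↔ e j) ∧ (f i ↔ f j)) →
    ∃ d, F false d = d ∧ E d x ∧ σ^[r] d = d ∧ (∀ i < r, 0 < i → σ^[i] d ≠ d) ∧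
      (∀ i, d ≠ v i) ∧
      (∀ i, F false (v i) = v i → E (v i) x → ∀ q ≤ n, 0 < q → σ^[r * q] (v i) = v i →
        (∀ q' < q, 0 < q' → σ^[r * q'] (v i) ≠ v i) →
        (PN F σ (r * q) d (v i) ↔ e i) ∧ (PN F σ (r * q) (v i) d ↔ f i)) ∧
      ∀ j < r, 0 < j → E (σ^[j] d) d → (PN F σ r d (σ^[j] d) ↔ w j)
  g3 : ∀ (k : ℕ) (x : N) (v : Fin k → N), ∃ d, F false d = d ∧ E d x ∧
    (∀ i ≤ n, 0 < i → σ^[i] d ≠ d) ∧ ∀ i, d ≠ v i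

section BF
variable {N₁ N₂ : Type u} (S₁ : Sys N₁) (S₂ : Sys N₂)

def Good (n : ℕ) (R : Set (N₁ × N₂)) : Prop :=
  ∀ p ∈ R, ∀ q ∈ R, ∀ z : ℤ, |z| ≤ n →
    (S₁.E ((S₁.s ^ z) p.1) q.1 ↔ S₂.E ((S₂.s ^ z) p.2) q.2) ∧
    ((S₁.s ^ z) p.1 = q.1 ↔ (S₂.s ^ z) p.2 = q.2) ∧
    ∀ t : ℤ, |t| ≤ n → (S₁.P t ((S₁.s ^ z) p.1) q.1 ↔ S₂.P t ((S₂.s ^ z) p.2) q.2)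

structure BF (n : ℕ) (R : Set (N₁ × N₂)) : Prop where
  fin : R.Finite
  cl : ∀ p ∈ R, ∀ i, (S₁.F i p.1, S₂.F i p.2) ∈ R
  good : Good S₁ S₂ n R

variable {S₁ S₂}

theorem Good.mono {m n : ℕ} (h : m ≤ n) {R : Set (N₁ × N₂)} (hR : Good S₁ S₂ n R) :
    Good S₁ S₂ m R := by
  intro p hp q hq z hz
  have := hR p hp q hq z (by omega)
  exact ⟨this.1, this.2.1, fun t ht => this.2.2 t (by omega)⟩

theorem BF.mono {m n : ℕ} (h : m ≤ n) {R : Set (N₁ × N₂)} (hR : BF S₁ S₂ n R) :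
    BF S₁ S₂ m R := ⟨hR.fin, hR.cl, hR.good.mono h⟩

theorem BF.swap {n : ℕ} {R : Set (N₁ × N₂)} (hR : BF S₁ S₂ n R) :
    BF S₂ S₁ n (Prod.swap ⁻¹' R) := by
  refine ⟨?_, ?_, ?_⟩
  · have := hR.fin.preimage (f := Prod.swap) (Prod.swap_injective.injOn)
    exact this
  · intro p hp i
    exact hR.cl _ hp i
  · intro p hp q hq z hz
    have := hR.good _ hp _ hq z hz
    exact ⟨this.1.symm, this.2.1.symm, fun t ht => (this.2.2 t ht).symm⟩

theorem Good.insert {n : ℕ} {R : Set (N₁ × N₂)} (hR : Good S₁ S₂ n R) {c : N₁} {d : N₂}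
    (h : ∀ x y, (x, y) ∈ R → ∀ z : ℤ, |z| ≤ n →
      (S₁.E ((S₁.s ^ z) c) x ↔ S₂.E ((S₂.s ^ z) d) y) ∧
      ((S₁.s ^ z) c = x ↔ (S₂.s ^ z) d = y) ∧
      ∀ t : ℤ, |t| ≤ n → (S₁.P t ((S₁.s ^ z) c) x ↔ S₂.P t ((S₂.s ^ z) d) y) ∧
        (S₁.P t ((S₁.s ^ z) x) c ↔ S₂.P t ((S₂.s ^ z) y) d))
    (h' : ∀ z : ℤ, |z| ≤ n →
      (S₁.E ((S₁.s ^ z) c) c ↔ S₂.E ((S₂.s ^ z) d) d) ∧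
      ((S₁.s ^ z) c = c ↔ (S₂.s ^ z) d = d) ∧
      ∀ t : ℤ, |t| ≤ n → (S₁.P t ((S₁.s ^ z) c) c ↔ S₂.P t ((S₂.s ^ z) d) d)) :
    Good S₁ S₂ n (insert (c, d) R) := by
  rintro p (rfl | hp) q (rfl | hq) z hz
  · exact h' z hz
  · have := h _ _ hq z hz
    exact ⟨this.1, this.2.1, fun t ht => (this.2.2 t ht).1⟩
  · have := h _ _ hp z hz
    have h2 := h _ _ hp (-z) (by simpa using hz)
    refine ⟨?_, ?_, fun t ht => (this.2.2 t ht).2⟩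
    · have e1 := S₁.zE' 0 z (x := c) (y := p.1)
      have e2 := S₂.zE' 0 z (x := d) (y := p.2)
      simp only [zpow_zero, zero_sub, Equiv.Perm.one_apply] at e1 e2
      rw [S₁.comm, S₂.comm, e1, e2]
      exact h2.1
    · have e1 := S₁.zEq 0 z (x := c) (y := p.1)
      have e2 := S₂.zEq 0 z (x := d) (y := p.2)
      simp only [zpow_zero, zero_sub, Equiv.Perm.one_apply] at e1 e2
      rw [eq_comm, e1, eq_comm (b := d), e2]
      exact h2.2.1
  · exact hR p hp q hq z hz

theorem BF.eqv {n : ℕ} {R : Set (N₁ × N₂)} (hR : BF S₁ S₂ n R) {x x' : N₁} {y y' : N₂}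
    (h : (x, y) ∈ R) (h' : (x', y') ∈ R) : x = x' ↔ y = y' := by
  have := (hR.good _ h _ h' 0 (by simp)).2.1
  simpa using this

theorem BF.Q {n : ℕ} {R : Set (N₁ × N₂)} (hR : BF S₁ S₂ n R) {x : N₁} {y : N₂}
    (h : (x, y) ∈ R) : S₁.Q x ↔ S₂.Q y :=
  hR.eqv (hR.cl _ h false) h

end BF

theorem fin_enum {α : Type u} {s : Set α} (hs : s.Finite) :
    ∃ (k : ℕ) (v : Fin k → α), ∀ a, a ∈ s ↔ ∃ i, v i = a := by
  classical
  refine ⟨hs.toFinset.card, fun i => (hs.toFinset.equivFin.symm i : α), fun a => ?_⟩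
  constructor
  · intro ha
    exact ⟨hs.toFinset.equivFin ⟨a, by simpa using ha⟩, by simp⟩
  · rintro ⟨i, rfl⟩
    have := (hs.toFinset.equivFin.symm i).2
    exact hs.mem_toFinset.1 this

theorem sub_dvd (H : AddSubgroup ℤ) {r : ℕ} (hr : 0 < r) (h : (r : ℤ) ∈ H)
    (hmin : ∀ i : ℕ, i < r → 0 < i → (i : ℤ) ∉ H) (z : ℤ) : z ∈ H ↔ (r : ℤ) ∣ z := by
  constructor
  · intro hz
    have h1 : z % r ∈ H := by
      rw [Int.emod_def, mul_comm]
      exact H.sub_mem hz (by simpa using H.zsmul_mem h (z / r))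
    have h2 : 0 ≤ z % r := Int.emod_nonneg _ (by omega)
    have h3 : z % r < r := Int.emod_lt_of_pos _ (by omega)
    obtain ⟨i, hi⟩ := Int.eq_ofNat_of_zero_le h2
    rw [hi] at h1 h3
    rw [Int.dvd_iff_emod_eq_zero, hi]
    by_contra h0
    exact hmin i (by omega) (by omega) h1
  · rintro ⟨k, rfl⟩
    rw [mul_comm]
    simpa using H.zsmul_mem h k

theorem sub_small (H : AddSubgroup ℤ) {r : ℕ}
    (hmin : ∀ i : ℕ, i < r → 0 < i → (i : ℤ) ∉ H) {z : ℤ} (hz : |z| < r) : z ∈ H ↔ z = 0 := by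
  constructor
  · intro h
    by_contra h0
    obtain ⟨n, rfl | rfl⟩ := z.eq_nat_or_neg
    · exact hmin n (by simpa using hz) (by omega) h
    · exact hmin n (by simpa using hz) (by omega) (by simpa using h)
  · rintro rfl; exact H.zero_mem

namespace Sys
variable {N : Type u} (S : Sys N)

def HE (x : N) : AddSubgroup ℤ where
  carrier := {z | S.E ((S.s ^ z) x) x}
  zero_mem' := by simpa using S.refl x
  add_mem' := by
    intro a b ha hb
    simp only [Set.mem_ofPred_eq] at *
    rw [S.zadd]
    exact S.trans ((S.zE a).2 hb) ha
  neg_mem' := by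
    intro a ha
    simp only [Set.mem_ofPred_eq] at *
    rw [← S.zE a]
    simpa using S.symm ha

def HP (x : N) : AddSubgroup ℤ where
  carrier := {z | (S.s ^ z) x = x}
  zero_mem' := by simp
  add_mem' := by
    intro a b ha hb
    simp only [Set.mem_ofPred_eq] at *
    rw [S.zadd, hb, ha]
  neg_mem' := by
    intro a ha
    simp only [Set.mem_ofPred_eq] at *
    apply (S.s ^ a).injective
    rw [← S.zadd]
    simpa using ha.symm

theorem mem_HE {x : N} {z : ℤ} : z ∈ S.HE x ↔ S.E ((S.s ^ z) x) x := Iff.rfl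
theorem mem_HP {x : N} {z : ℤ} : z ∈ S.HP x ↔ (S.s ^ z) x = x := Iff.rfl

theorem zcomm (z w : ℤ) (x : N) : (S.s ^ z) ((S.s ^ w) x) = (S.s ^ w) ((S.s ^ z) x) := by
  rw [← S.zadd, add_comm, S.zadd]

end Sys

section
variable {N₁ N₂ : Type u} {S₁ : Sys N₁} {S₂ : Sys N₂}

theorem classstep {n : ℕ} (hG : Gen S₂.E S₂.F S₂.s n) {R : Set (N₁ × N₂)}
    (hR : BF S₁ S₂ (n * n + 4 * n) R) (c : N₁) :
    ∃ y₀ : N₂, (∀ x y, (x, y) ∈ R → ∀ z : ℤ, |z| ≤ n →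
      (S₁.E ((S₁.s ^ z) c) x ↔ S₂.E ((S₂.s ^ z) y₀) y)) ∧
      ∀ z : ℤ, |z| ≤ n → (S₁.E ((S₁.s ^ z) c) c ↔ S₂.E ((S₂.s ^ z) y₀) y₀) := by
  classical
  have hn2 : 0 ≤ n * n := Nat.zero_le _
  by_cases hex : ∃ x y, (x, y) ∈ R ∧ ∃ z : ℤ, |z| ≤ n ∧ S₁.E ((S₁.s ^ z) c) x
  · obtain ⟨x, y, hxy, z, hz, hE⟩ := hex
    have hE' : S₁.E c ((S₁.s ^ (-z)) x) := by
      rw [← S₁.zE z]; simpa using hE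
    refine ⟨(S₂.s ^ (-z)) y, ?_, ?_⟩
    · intro x' y' h' w hw
      rw [S₁.congr ((S₁.zE w).2 hE') (S₁.refl x'), ← S₁.zadd, ← S₂.zadd]
      refine (hR.good _ hxy _ h' _ ?_).1
      have := abs_add_le w (-z)
      rw [abs_neg] at this
      push_cast; lia
    · intro w hw
      rw [S₁.congr ((S₁.zE w).2 hE') hE', ← S₁.zadd, ← S₂.zadd, S₁.zE', S₂.zE']
      refine (hR.good _ hxy _ hxy _ ?_).1
      simp only [add_sub_cancel_right]
      push_cast; lia
  · push Not at hex
    have hr : ∃ r : ℕ, 0 < r ∧ (r = n + 1 ∨ S₁.E ((S₁.s ^ (r : ℤ)) c) c) := ⟨n + 1, by omega, Or.inl rfl⟩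
    obtain ⟨hr0, hr1⟩ := Nat.find_spec hr
    have hmin : ∀ i < Nat.find hr, 0 < i → ¬ S₁.E ((S₁.s ^ (i : ℤ)) c) c := by
      intro i hi h0 hE
      exact Nat.find_min hr hi ⟨h0, Or.inr hE⟩
    have hle : Nat.find hr ≤ n + 1 := Nat.find_min' hr ⟨by omega, Or.inl rfl⟩
    generalize Nat.find hr = r at *
    have hfin : ((fun p : (N₁ × N₂) × ℤ => (S₂.s ^ (-p.2)) p.1.2) '' (R ×ˢ Set.Icc (-(n : ℤ)) n)).Finite :=
      (hR.fin.prod (Set.finite_Icc _ _)).image _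
    obtain ⟨k, v, hv⟩ := fin_enum hfin
    obtain ⟨y₀, h1, h2, h3⟩ := hG.g1 r hr0 hle k v
    simp only [Equiv.Perm.iterate_eq_pow] at h1 h2
    refine ⟨y₀, ?_, ?_⟩
    · intro x y hxy z hz
      refine iff_of_false (hex x y hxy z hz) ?_
      intro hE
      obtain ⟨i, hi⟩ := (hv ((S₂.s ^ (-z)) y)).1 ⟨((x, y), z), ⟨hxy, by rw [abs_le] at hz; exact hz⟩, rfl⟩
      apply h3 i
      rw [hi, ← S₂.zE z]
      simpa using hE
    · intro z hz
      have h2' : ∀ i < r, 0 < i → (i : ℤ) ∉ S₂.HE y₀ := by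
        intro i hi h0; rw [S₂.mem_HE, zpow_natCast]; exact h2 i hi h0
      rw [← S₁.mem_HE, ← S₂.mem_HE]
      rcases hr1 with hr1 | hr1
      · rw [sub_small _ hmin (by lia), sub_small _ h2' (by lia)]
      · rw [sub_dvd _ hr0 hr1 hmin, sub_dvd _ hr0 (by simpa [S₂.mem_HE] using h1) h2']

theorem Pmatch {n r : ℕ} (hr : 0 < r) {c a : N₁} {d b : N₂}
    (hc : ∀ z : ℤ, (S₁.s ^ z) c = c ↔ (r : ℤ) ∣ z) (hd : ∀ z : ℤ, (S₂.s ^ z) d = d ↔ (r : ℤ) ∣ z)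
    (Qc : S₁.Q c) (Qd : S₂.Q d) (Qa : S₁.Q a) (Qb : S₂.Q b) (hca : S₁.E c a) (hdb : S₂.E d b)
    (nca : c ≠ a) (ndb : d ≠ b)
    (hper : ∀ z : ℤ, |z| ≤ n → ((S₁.s ^ z) a = a ↔ (S₂.s ^ z) b = b))
    (hsig : ∀ q : ℕ, 0 < q → r * q ≤ n → (S₁.s ^ ((r : ℤ) * q)) a = a →
      (∀ q' < q, 0 < q' → (S₁.s ^ ((r : ℤ) * (q' : ℕ))) a ≠ a) →
      (S₁.P (r * q) c a ↔ S₂.P (r * q) d b) ∧ (S₁.P (r * q) a c ↔ S₂.P (r * q) b d))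
    (t : ℤ) (ht : |t| ≤ n) :
    (S₁.P t c a ↔ S₂.P t d b) ∧ (S₁.P t a c ↔ S₂.P t b d) := by
  classical
  by_cases hrt : (r : ℤ) ∣ t
  swap
  · refine ⟨iff_of_false ?_ ?_, iff_of_false ?_ ?_⟩
    · exact fun h => hrt ((hc t).1 (Sys.P_prop h).2.2.2.2.1)
    · exact fun h => hrt ((hd t).1 (Sys.P_prop h).2.2.2.2.1)
    · exact fun h => hrt ((hc t).1 (Sys.P_prop h).2.2.2.2.2)
    · exact fun h => hrt ((hd t).1 (Sys.P_prop h).2.2.2.2.2)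
  by_cases hta : (S₁.s ^ t) a = a
  swap
  · have htb := fun h => hta ((hper t ht).2 h)
    refine ⟨iff_of_false ?_ ?_, iff_of_false ?_ ?_⟩
    · exact fun h => hta (Sys.P_prop h).2.2.2.2.2
    · exact fun h => htb (Sys.P_prop h).2.2.2.2.2
    · exact fun h => hta (Sys.P_prop h).2.2.2.2.1
    · exact fun h => htb (Sys.P_prop h).2.2.2.2.1
  by_cases ht0 : t = 0
  · subst ht0
    simp only [Sys.P_zero]
    refine ⟨iff_of_true ?_ ?_, iff_of_true ?_ ?_⟩
    · exact ⟨Qc, Qa, hca, nca⟩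
    · exact ⟨Qd, Qb, hdb, ndb⟩
    · exact ⟨Qa, Qc, S₁.symm hca, nca.symm⟩
    · exact ⟨Qb, Qd, S₂.symm hdb, ndb.symm⟩
  obtain ⟨m, rfl⟩ := hrt
  let H : AddSubgroup ℤ := (S₁.HP a).comap (AddMonoidHom.mulLeft (r : ℤ))
  have memH : ∀ z, z ∈ H ↔ (S₁.s ^ ((r : ℤ) * z)) a = a := fun z => Iff.rfl
  have hmH : m ∈ H := (memH m).2 hta
  have hm0 : m ≠ 0 := by rintro rfl; simp at ht0
  have hex : ∃ q : ℕ, 0 < q ∧ (q : ℤ) ∈ H := by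
    refine ⟨m.natAbs, by omega, ?_⟩
    rcases Int.natAbs_eq m with h | h
    · rw [← h]; exact hmH
    · have := H.neg_mem hmH
      rw [h, neg_neg] at this; simpa using this
  obtain ⟨hq0, hqH⟩ := Nat.find_spec hex
  have hmin : ∀ i < Nat.find hex, 0 < i → (i : ℤ) ∉ H := fun i hi h0 hh =>
    Nat.find_min hex hi ⟨h0, hh⟩
  generalize Nat.find hex = q at *
  obtain ⟨m', rfl⟩ := (sub_dvd H hq0 hqH hmin m).1 hmH
  have hrq : r * q ≤ n := by
    have hm' : m' ≠ 0 := by rintro rfl; simp at hm0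
    have h1 : 1 ≤ |m'| := Int.one_le_abs hm'
    rw [← mul_assoc, abs_mul] at ht
    have h2 : |(r : ℤ) * q| = (r * q : ℕ) := by push_cast; rw [abs_of_nonneg (by positivity)]
    rw [h2] at ht
    have : ((r * q : ℕ) : ℤ) ≤ n := by nlinarith
    exact_mod_cast this
  obtain ⟨s1, s2⟩ := hsig q hq0 hrq ((memH _).1 hqH) (fun q' h1 h2 h3 => hmin q' h1 h2 h3)
  have hca' : (S₁.s ^ ((r : ℤ) * q)) c = c := (hc _).2 (Dvd.intro _ rfl)
  have hda' : (S₂.s ^ ((r : ℤ) * q)) d = d := (hd _).2 (Dvd.intro _ rfl)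
  have hba' : (S₂.s ^ ((r : ℤ) * q)) b = b := (hper _ (by
    rw [abs_of_nonneg (by positivity)]; exact_mod_cast hrq)).1 ((memH _).1 hqH)
  rw [← mul_assoc, S₁.P_mul Qc Qa hca nca hca' ((memH _).1 hqH), S₂.P_mul Qd Qb hdb ndb hda' hba',
    S₁.P_mul Qa Qc (S₁.symm hca) nca.symm ((memH _).1 hqH) hca',
    S₂.P_mul Qb Qd (S₂.symm hdb) ndb.symm hba' hda', s1, s2]
  exact ⟨Iff.rfl, Iff.rfl⟩

end

section
variable {N₁ N₂ : Type u} {S₁ : Sys N₁} {S₂ : Sys N₂}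

theorem good_orbit {n : ℕ} {R : Set (N₁ × N₂)} (hR : Good S₁ S₂ (3 * n) R) {x : N₁} {y : N₂}
    (hxy : (x, y) ∈ R) {z : ℤ} (hz : |z| ≤ n) :
    Good S₁ S₂ n (insert ((S₁.s ^ z) x, (S₂.s ^ z) y) R) := by
  apply Good.insert (hR.mono (by omega))
  · intro x' y' h' w hw
    rw [← S₁.zadd, ← S₂.zadd]
    have hb : |w + z| ≤ (3 * n : ℕ) := by
      have := abs_add_le w z; push_cast; lia
    have := hR _ hxy _ h' _ hb
    refine ⟨this.1, this.2.1, fun t ht => ⟨this.2.2 t (by push_cast; lia), ?_⟩⟩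
    rw [S₁.P_zz, S₂.P_zz]
    have hb : |w - z| ≤ (3 * n : ℕ) := by
      have := abs_sub w z; push_cast; lia
    exact (hR _ h' _ hxy _ hb).2.2 t (by push_cast; lia)
  · intro w hw
    rw [S₁.zcomm, S₂.zcomm, S₁.zE, S₂.zE, (S₁.s ^ z).injective.eq_iff, (S₂.s ^ z).injective.eq_iff]
    have := hR _ hxy _ hxy w (by push_cast; lia)
    refine ⟨this.1, this.2.1, fun t ht => ?_⟩
    rw [S₁.P_shift, S₂.P_shift]
    exact this.2.2 t (by push_cast; lia)

theorem qins {n : ℕ} {R : Set (N₁ × N₂)} (hR : BF S₁ S₂ (2 * n) R) {c : N₁} {d : N₂} (y₀ : N₂)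
    (hdy : S₂.E d y₀)
    (hy1 : ∀ x y, (x, y) ∈ R → ∀ z : ℤ, |z| ≤ n →
      (S₁.E ((S₁.s ^ z) c) x ↔ S₂.E ((S₂.s ^ z) y₀) y))
    (hy2 : ∀ z : ℤ, |z| ≤ n → (S₁.E ((S₁.s ^ z) c) c ↔ S₂.E ((S₂.s ^ z) y₀) y₀))
    (hne1 : ∀ x y, (x, y) ∈ R → ∀ z : ℤ, |z| ≤ n → c ≠ (S₁.s ^ z) x)
    (hne2 : ∀ x y, (x, y) ∈ R → ∀ z : ℤ, |z| ≤ n → d ≠ (S₂.s ^ z) y)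
    (hper : ∀ z : ℤ, |z| ≤ n → ((S₁.s ^ z) c = c ↔ (S₂.s ^ z) d = d))
    (hP : ∀ x y, (x, y) ∈ R → ∀ z : ℤ, |z| ≤ n → S₁.Q ((S₁.s ^ z) x) → S₂.Q ((S₂.s ^ z) y) →
      S₁.E c ((S₁.s ^ z) x) → S₂.E d ((S₂.s ^ z) y) → ∀ t : ℤ, |t| ≤ n →
      (S₁.P t c ((S₁.s ^ z) x) ↔ S₂.P t d ((S₂.s ^ z) y)) ∧
      (S₁.P t ((S₁.s ^ z) x) c ↔ S₂.P t ((S₂.s ^ z) y) d))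
    (hPs : ∀ z : ℤ, |z| ≤ n → S₁.E ((S₁.s ^ z) c) c → S₂.E ((S₂.s ^ z) d) d →
      ∀ t : ℤ, |t| ≤ n → (S₁.P t ((S₁.s ^ z) c) c ↔ S₂.P t ((S₂.s ^ z) d) d)) :
    Good S₁ S₂ n (insert (c, d) R) := by
  have key : ∀ x y, (x, y) ∈ R → ∀ z : ℤ, |z| ≤ n → ∀ t : ℤ, |t| ≤ n →
      (S₁.P t c ((S₁.s ^ z) x) ↔ S₂.P t d ((S₂.s ^ z) y)) ∧
      (S₁.P t ((S₁.s ^ z) x) c ↔ S₂.P t ((S₂.s ^ z) y) d) := by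
    intro x y hxy z hz t ht
    by_cases hq : S₁.Q ((S₁.s ^ z) x)
    swap
    · have hq' : ¬ S₂.Q ((S₂.s ^ z) y) := by rwa [S₂.zQ, ← hR.Q hxy, ← S₁.zQ z]
      exact ⟨iff_of_false (fun h => hq (Sys.P_prop h).2.1) (fun h => hq' (Sys.P_prop h).2.1),
        iff_of_false (fun h => hq (Sys.P_prop h).1) (fun h => hq' (Sys.P_prop h).1)⟩
    have hq' : S₂.Q ((S₂.s ^ z) y) := by rwa [S₂.zQ, ← hR.Q hxy, ← S₁.zQ z]
    have hEE : S₁.E c ((S₁.s ^ z) x) ↔ S₂.E d ((S₂.s ^ z) y) := by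
      have e1 := S₁.zE' 0 z (x := c) (y := x)
      have e2 := S₂.zE' 0 z (x := y₀) (y := y)
      simp only [zpow_zero, zero_sub, Equiv.Perm.one_apply] at e1 e2
      rw [S₂.congr hdy (S₂.refl _), e1, e2]
      exact hy1 x y hxy (-z) (by simpa using hz)
    by_cases hE : S₁.E c ((S₁.s ^ z) x)
    · exact hP x y hxy z hz hq hq' hE (hEE.1 hE) t ht
    · have hE' := fun h => hE (hEE.2 h)
      exact ⟨iff_of_false (fun h => hE (Sys.P_prop h).2.2.1) (fun h => hE' (Sys.P_prop h).2.2.1),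
        iff_of_false (fun h => hE (S₁.symm (Sys.P_prop h).2.2.1)) (fun h => hE' (S₂.symm (Sys.P_prop h).2.2.1))⟩
  apply Good.insert (hR.good.mono (by omega))
  · intro x y hxy z hz
    refine ⟨?_, ?_, ?_⟩
    · rw [S₂.congr ((S₂.zE z).2 hdy) (S₂.refl y)]
      exact hy1 x y hxy z hz
    · refine iff_of_false ?_ ?_
      · intro h
        apply hne1 x y hxy (-z) (by simpa using hz)
        rw [← h]; simp
      · intro h
        apply hne2 x y hxy (-z) (by simpa using hz)
        rw [← h]; simp
    · intro t ht
      refine ⟨?_, (key x y hxy z hz t ht).2⟩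
      have e1 := S₁.P_zz' t z 0 (a := c) (b := x)
      have e2 := S₂.P_zz' t z 0 (a := d) (b := y)
      simp only [zpow_zero, zero_sub, Equiv.Perm.one_apply] at e1 e2
      rw [e1, e2]
      exact (key x y hxy (-z) (by simpa using hz) t ht).1
  · intro z hz
    have hEE : S₁.E ((S₁.s ^ z) c) c ↔ S₂.E ((S₂.s ^ z) d) d := by
      rw [S₂.congr ((S₂.zE z).2 hdy) hdy]; exact hy2 z hz
    refine ⟨hEE, hper z hz, fun t ht => ?_⟩
    by_cases hE : S₁.E ((S₁.s ^ z) c) c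
    · exact hPs z hz hE (hEE.1 hE) t ht
    · have hE' := fun h => hE (hEE.2 h)
      exact iff_of_false (fun h => hE (Sys.P_prop h).2.2.1) (fun h => hE' (Sys.P_prop h).2.2.1)

theorem qstep {n : ℕ} (hG : Gen S₂.E S₂.F S₂.s n) {R : Set (N₁ × N₂)}
    (hR : BF S₁ S₂ (n * n + 4 * n) R) (c : N₁) (hQ : S₁.Q c) :
    ∃ d, S₂.Q d ∧ Good S₁ S₂ n (insert (c, d) R) := by
  classical
  by_cases hex : ∃ x y, (x, y) ∈ R ∧ ∃ z : ℤ, |z| ≤ n ∧ c = (S₁.s ^ z) x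
  · obtain ⟨x, y, hxy, z, hz, rfl⟩ := hex
    exact ⟨(S₂.s ^ z) y, by rwa [S₂.zQ, ← hR.Q hxy, ← S₁.zQ z],
      good_orbit (hR.good.mono (by have := Nat.zero_le (n * n); omega)) hxy hz⟩
  push Not at hex
  obtain ⟨y₀, hy1, hy2⟩ := classstep hG hR c
  have hR2 : BF S₁ S₂ (2 * n) R := hR.mono (by have := Nat.zero_le (n * n); omega)
  have hfin : ((fun p : (N₁ × N₂) × ℤ => ((S₁.s ^ p.2) p.1.1, (S₂.s ^ p.2) p.1.2)) ''
      (R ×ˢ Set.Icc (-(n : ℤ)) n)).Finite :=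
    (hR.fin.prod (Set.finite_Icc _ _)).image _
  obtain ⟨k, v, hv⟩ := fin_enum hfin
  have hv' : ∀ x y, (x, y) ∈ R → ∀ z : ℤ, |z| ≤ n → ∃ i, v i = ((S₁.s ^ z) x, (S₂.s ^ z) y) := by
    intro x y hxy z hz
    exact (hv _).1 ⟨((x, y), z), ⟨hxy, by rw [abs_le] at hz; exact hz⟩, rfl⟩
  by_cases hrr : ∃ r : ℕ, 0 < r ∧ r ≤ n ∧ (S₁.s ^ (r : ℤ)) c = c
  · obtain ⟨hr0, hrn, hrc⟩ := Nat.find_spec hrr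
    have hmin : ∀ i < Nat.find hrr, 0 < i → (i : ℤ) ∉ S₁.HP c := by
      intro i hi h0 hE
      exact Nat.find_min hrr hi ⟨h0, by omega, hE⟩
    generalize Nat.find hrr = r at *
    have hc : ∀ z : ℤ, (S₁.s ^ z) c = c ↔ (r : ℤ) ∣ z := sub_dvd (S₁.HP c) hr0 hrc hmin
    let D : N₁ → (ℤ → Prop) → Prop := fun a p => ∃ q : ℕ, q ≤ n ∧ 0 < q ∧ (S₁.s ^ ((r : ℤ) * q)) a = a ∧
      (∀ q' < q, 0 < q' → (S₁.s ^ ((r : ℤ) * (q' : ℕ))) a ≠ a) ∧ p (r * q)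
    have hD : ∀ a p, ∀ q : ℕ, q ≤ n → 0 < q → (S₁.s ^ ((r : ℤ) * q)) a = a →
        (∀ q' < q, 0 < q' → (S₁.s ^ ((r : ℤ) * (q' : ℕ))) a ≠ a) → (D a p ↔ p (r * q)) := by
      intro a p q h1 h2 h3 h4
      refine ⟨?_, fun h => ⟨q, h1, h2, h3, h4, h⟩⟩
      rintro ⟨q', h1', h2', h3', h4', h⟩
      rcases lt_trichotomy q q' with h5 | h5 | h5
      · exact absurd h3 (h4' _ h5 h2)
      · rw [h5]; exact h
      · exact absurd h3' (h4 _ h5 h2')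
    have hnE : S₂.E (S₂.s^[r] y₀) y₀ := by
      rw [Equiv.Perm.iterate_eq_pow, ← zpow_natCast]
      rw [← hy2 r (by simpa using hrn), hrc]; exact S₁.refl c
    -- matching of periods
    have hperA : ∀ i, ∀ z : ℤ, |z| ≤ (n * n : ℕ) + 2 * n →
        ((S₁.s ^ z) (v i).1 = (v i).1 ↔ (S₂.s ^ z) (v i).2 = (v i).2) := by
      intro i z hz
      obtain ⟨⟨⟨x, y⟩, w⟩, ⟨hxy, hw⟩, hi⟩ := (hv _).2 ⟨i, rfl⟩
      simp only at hi
      rw [← hi]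
      simp only
      rw [S₁.zcomm, S₂.zcomm, (S₁.s ^ w).injective.eq_iff, (S₂.s ^ w).injective.eq_iff]
      exact (hR.good _ hxy _ hxy z (by push_cast at *; lia)).2.1
    have hnn : ∀ q ≤ n, r * q ≤ n * n := fun q hq => Nat.mul_le_mul hrn hq
    obtain ⟨d, hd1, hd2, hd3, hd4, hd5, hd6, hd7⟩ := hG.g2 r hr0 hrn k
      (fun i => D (v i).1 (fun t => S₁.P t c (v i).1)) (fun i => D (v i).1 (fun t => S₁.P t (v i).1 c))
      (fun j => S₁.P r c ((S₁.s ^ j) c)) y₀ (fun i => (v i).2) hnE (by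
        intro i j q hq hij
        rw [Equiv.Perm.iterate_eq_pow, ← zpow_natCast] at hij
        have hij' : (S₁.s ^ ((r * q : ℕ) : ℤ)) (v i).1 = (v j).1 := by
          obtain ⟨⟨⟨x, y⟩, w⟩, ⟨hxy, hw⟩, hi⟩ := (hv _).2 ⟨i, rfl⟩
          obtain ⟨⟨⟨x', y'⟩, w'⟩, ⟨hxy', hw'⟩, hj⟩ := (hv _).2 ⟨j, rfl⟩
          simp only at hi hj hw hw'
          rw [← hi, ← hj] at hij ⊢
          simp only at hij ⊢
          rw [← S₂.zadd, S₂.zEq] at hij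
          rw [← S₁.zadd, S₁.zEq]
          refine (hR.good _ hxy _ hxy' _ ?_).2.1.2 hij
          have h1 := hnn q hq
          simp only [Set.mem_Icc] at hw hw'
          rw [abs_le]
          constructor <;> push_cast <;> zify at h1 <;> nlinarith
        have hfixc : (S₁.s ^ ((r * q : ℕ) : ℤ)) c = c := (hc _).2 ⟨q, by push_cast; ring⟩
        have hP1 : ∀ t : ℤ, S₁.P t c (v j).1 ↔ S₁.P t c (v i).1 := by
          intro t; rw [← hij']; nth_rw 1 [← hfixc]; rw [S₁.P_shift]
        have hP2 : ∀ t : ℤ, S₁.P t (v j).1 c ↔ S₁.P t (v i).1 c := by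
          intro t; rw [← hij']; nth_rw 1 [← hfixc]; rw [S₁.P_shift]
        have hfx : ∀ z : ℤ, (S₁.s ^ z) (v j).1 = (v j).1 ↔ (S₁.s ^ z) (v i).1 = (v i).1 := by
          intro z; rw [← hij', S₁.zcomm, Equiv.apply_eq_iff_eq]
        simp only [D, hP1, hP2, hfx, ne_eq, and_self])
    have hdd : ∀ z : ℤ, (S₂.s ^ z) d = d ↔ (r : ℤ) ∣ z := by
      refine sub_dvd (S₂.HP d) hr0 ?_ ?_
      · rw [S₂.mem_HP, zpow_natCast, ← Equiv.Perm.iterate_eq_pow]; exact hd3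
      · intro i h1 h2
        rw [S₂.mem_HP, zpow_natCast, ← Equiv.Perm.iterate_eq_pow]; exact hd4 i h1 h2
    refine ⟨d, hd1, qins hR2 y₀ hd2 hy1 hy2 hex ?_ ?_ ?_ ?_⟩
    · intro x y hxy z hz
      obtain ⟨i, hi⟩ := hv' x y hxy z hz
      have := hd5 i
      rwa [hi] at this
    · intro z hz; rw [hc, hdd]
    · intro x y hxy z hz hq1 hq2 hE1 hE2 t ht
      obtain ⟨i, hi⟩ := hv' x y hxy z hz
      have h5 := hd5 i
      have h6 := hd6 i
      have hp := hperA i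
      rw [hi] at h5 h6 hp
      simp only at h5 h6 hp
      refine Pmatch hr0 hc hdd hQ hd1 hq1 hq2 hE1 hE2 (hex x y hxy z hz) h5
        (fun w hw => hp w (by push_cast; nlinarith)) ?_ t ht
      intro q hq0 hrq hfix hminq
      have hqn : q ≤ n := le_trans (Nat.le_mul_of_pos_left q hr0) hrq
      have hb : ∀ q' ≤ q, |((r * q' : ℕ) : ℤ)| ≤ ((n * n : ℕ) : ℤ) + 2 * n := by
        intro q' hq'
        have h1 := hnn q' (by omega)
        simp only [Nat.abs_cast]
        zify at h1; push_cast; nlinarith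
      have := h6 hq2 (S₂.trans (S₂.symm hE2) hd2) q hqn hq0 (by
        have := (hp (r * q : ℕ) (hb q le_rfl)).1 (by push_cast; exact hfix)
        rwa [Equiv.Perm.iterate_eq_pow, ← zpow_natCast]) (by
        intro q' h1 h2 h3
        rw [Equiv.Perm.iterate_eq_pow, ← zpow_natCast] at h3
        have := (hp (r * q' : ℕ) (hb q' h1.le)).2 h3
        exact hminq q' h1 h2 (by push_cast at this; exact this))
      rw [S₂.PN_iff, S₂.PN_iff] at this
      have k1 := hD _ (fun t => S₁.P t c ((S₁.s ^ z) x)) q hqn hq0 hfix hminq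
      have k2 := hD _ (fun t => S₁.P t ((S₁.s ^ z) x) c) q hqn hq0 hfix hminq
      push_cast at this
      exact ⟨(this.1.trans k1).symm, (this.2.trans k2).symm⟩
    · intro z hz hE1 hE2 t ht
      by_cases hrt : (r : ℤ) ∣ t
      swap
      · exact iff_of_false (fun h => hrt ((hc t).1 (Sys.P_prop h).2.2.2.2.2))
          (fun h => hrt ((hdd t).1 (Sys.P_prop h).2.2.2.2.2))
      obtain ⟨m, rfl⟩ := hrt
      have e1 := S₁.P_zz' (r * m) z 0 (a := c) (b := c)
      have e2 := S₂.P_zz' (r * m) z 0 (a := d) (b := d)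
      simp only [zpow_zero, zero_sub, Equiv.Perm.one_apply] at e1 e2
      rw [e1, e2]
      obtain ⟨j, hj⟩ := Int.eq_ofNat_of_zero_le (Int.emod_nonneg (-z) (b := r) (by omega))
      have hjr : (j : ℤ) < r := by rw [← hj]; exact Int.emod_lt_of_pos _ (by omega)
      have hzj : -z = j + r * (-z / r) := by rw [← hj]; exact (Int.emod_add_mul_ediv _ _).symm
      have f1 : (S₁.s ^ (-z)) c = (S₁.s ^ j) c := by
        rw [hzj, S₁.zadd, (hc _).2 (Dvd.intro _ rfl), zpow_natCast]
      have f2 : (S₂.s ^ (-z)) d = (S₂.s ^ j) d := by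
        rw [hzj, S₂.zadd, (hdd _).2 (Dvd.intro _ rfl), zpow_natCast]
      rw [f1, f2]
      by_cases hj0 : j = 0
      · subst hj0
        exact iff_of_false (fun h => (Sys.P_prop h).2.2.2.1 (by simp))
          (fun h => (Sys.P_prop h).2.2.2.1 (by simp))
      have g1 : S₁.E c ((S₁.s ^ j) c) := by
        rw [← f1, ← S₁.zE z]; simpa using hE1
      have g2 : S₂.E d ((S₂.s ^ j) d) := by
        rw [← f2, ← S₂.zE z]; simpa using hE2
      have n1 : c ≠ (S₁.s ^ j) c := by
        intro h; rw [← zpow_natCast, eq_comm, hc] at h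
        have := Int.le_of_dvd (by omega) h; omega
      have n2 : d ≠ (S₂.s ^ j) d := by
        intro h; rw [← zpow_natCast, eq_comm, hdd] at h
        have := Int.le_of_dvd (by omega) h; omega
      have q1 : S₁.Q ((S₁.s ^ j) c) := by rwa [← zpow_natCast, S₁.zQ]
      have q2 : S₂.Q ((S₂.s ^ j) d) := by rw [← zpow_natCast, S₂.zQ]; exact hd1
      have r1 : (S₁.s ^ (r : ℤ)) ((S₁.s ^ j) c) = (S₁.s ^ j) c := by
        rw [← zpow_natCast _ j, S₁.zcomm, hrc]
      have r2' : (S₂.s ^ (r : ℤ)) d = d := (hdd _).2 dvd_rfl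
      have r2 : (S₂.s ^ (r : ℤ)) ((S₂.s ^ j) d) = (S₂.s ^ j) d := by
        rw [← zpow_natCast _ j, S₂.zcomm, r2']
      rw [S₁.P_mul hQ q1 g1 n1 hrc r1, S₂.P_mul hd1 q2 g2 n2 r2' r2]
      have := hd7 j (by omega) (by omega) (by rw [Equiv.Perm.iterate_eq_pow]; exact S₂.symm g2)
      rw [S₂.PN_iff, Equiv.Perm.iterate_eq_pow] at this
      rw [this]
  · have hmin1 : ∀ i < n + 1, 0 < i → (i : ℤ) ∉ S₁.HP c := by
      intro i hi h0 hE
      exact hrr ⟨i, h0, by omega, hE⟩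
    obtain ⟨d, hd1, hd2, hd3, hd4⟩ := hG.g3 k y₀ (fun i => (v i).2)
    have hmin2 : ∀ i < n + 1, 0 < i → (i : ℤ) ∉ S₂.HP d := by
      intro i hi h0 hE
      rw [S₂.mem_HP, zpow_natCast, ← Equiv.Perm.iterate_eq_pow] at hE
      exact hd3 i (by omega) h0 hE
    have h1 : ∀ z : ℤ, |z| ≤ n → ((S₁.s ^ z) c = c ↔ z = 0) := fun z hz =>
      sub_small (S₁.HP c) hmin1 (by push_cast; lia)
    have h2 : ∀ z : ℤ, |z| ≤ n → ((S₂.s ^ z) d = d ↔ z = 0) := fun z hz =>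
      sub_small (S₂.HP d) hmin2 (by push_cast; lia)
    have hne2 : ∀ x y, (x, y) ∈ R → ∀ z : ℤ, |z| ≤ n → d ≠ (S₂.s ^ z) y := by
      intro x y hxy z hz
      obtain ⟨i, hi⟩ := hv' x y hxy z hz
      have := hd4 i
      rwa [hi] at this
    refine ⟨d, hd1, qins hR2 y₀ hd2 hy1 hy2 hex hne2 ?_ ?_ ?_⟩
    · intro z hz; rw [h1 z hz, h2 z hz]
    · intro x y hxy z hz hq1 hq2 hE1 hE2 t ht
      by_cases ht0 : t = 0
      · subst ht0
        simp only [Sys.P_zero]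
        exact ⟨iff_of_true ⟨hQ, hq1, hE1, hex x y hxy z hz⟩ ⟨hd1, hq2, hE2, hne2 x y hxy z hz⟩,
          iff_of_true ⟨hq1, hQ, S₁.symm hE1, (hex x y hxy z hz).symm⟩
            ⟨hq2, hd1, S₂.symm hE2, (hne2 x y hxy z hz).symm⟩⟩
      · exact ⟨iff_of_false (fun h => ht0 ((h1 t ht).1 (Sys.P_prop h).2.2.2.2.1))
          (fun h => ht0 ((h2 t ht).1 (Sys.P_prop h).2.2.2.2.1)),
          iff_of_false (fun h => ht0 ((h1 t ht).1 (Sys.P_prop h).2.2.2.2.2))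
          (fun h => ht0 ((h2 t ht).1 (Sys.P_prop h).2.2.2.2.2))⟩
    · intro z hz hE1 hE2 t ht
      by_cases ht0 : t = 0
      · subst ht0
        simp only [Sys.P_zero, S₁.zQ, S₂.zQ, ne_eq]
        rw [h1 z hz, h2 z hz]
        simp [hQ, hE1, hE2, show S₂.Q d from hd1]
      · exact iff_of_false (fun h => ht0 ((h1 t ht).1 (Sys.P_prop h).2.2.2.2.2))
          (fun h => ht0 ((h2 t ht).1 (Sys.P_prop h).2.2.2.2.2))

end

section
variable {N₁ N₂ : Type u} {S₁ : Sys N₁} {S₂ : Sys N₂}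

theorem fibstep {n : ℕ} {R : Set (N₁ × N₂)}
    (hR : BF S₁ S₂ (3 * n) R) {c : N₁} (hQ : ¬ S₁.Q c) {d' : Bool → N₂}
    (hd' : ∀ i, (S₁.F i c, d' i) ∈ R) :
    ∃ d, (∀ i, S₂.F i d = d' i) ∧ Good S₁ S₂ n (insert (c, d) R) := by
  classical
  have horb : ∀ x y, (x, y) ∈ R → ∀ z : ℤ, |z| ≤ n →
      ((∀ i, S₁.F i ((S₁.s ^ z) x) = S₁.F i c) ↔ (∀ i, S₂.F i ((S₂.s ^ z) y) = d' i)) := by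
    intro x y hxy z hz
    refine forall_congr' fun i => ?_
    rw [S₁.zF, S₂.zF]
    exact (hR.good _ (hR.cl _ hxy i) _ (hd' i) z (by push_cast; lia)).2.1
  by_cases hex : ∃ x y, (x, y) ∈ R ∧ ∃ z : ℤ, |z| ≤ n ∧ c = (S₁.s ^ z) x
  · obtain ⟨x, y, hxy, z, hz, rfl⟩ := hex
    exact ⟨(S₂.s ^ z) y, (horb x y hxy z hz).1 (fun i => rfl), good_orbit hR.good hxy hz⟩
  push Not at hex
  have hq : ∀ i, S₂.Q (d' i) := fun i => (hR.Q (hd' i)).1 (S₁.QF _ _)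
  have hE12 : S₂.E (d' false) (d' true) := by
    have := (hR.good _ (hd' false) _ (hd' true) 0 (by simp)).1
    simp only [zpow_zero, Equiv.Perm.one_apply] at this
    exact this.1 (S₁.trans (S₁.FE _ _) (S₁.symm (S₁.FE _ _)))
  have hne12 : d' false ≠ d' true := by
    intro h
    exact hQ (S₁.Finj _ ((hR.eqv (hd' false) (hd' true)).2 h))
  obtain ⟨p, q, hpq, hpQ, hqQ, hF, hp1, hp2⟩ := S₂.fibx (hq _) (hq _) hE12 hne12
  have hpF : ∀ i, S₂.F i p = d' i := by intro i; cases i <;> assumption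
  -- choose d
  have hd : ∃ d, (∀ i, S₂.F i d = d' i) ∧ ¬ S₂.Q d ∧
      ∀ x y, (x, y) ∈ R → ∀ z : ℤ, |z| ≤ n → d ≠ (S₂.s ^ z) y := by
    by_cases hex2 : ∃ x y, (x, y) ∈ R ∧ ∃ z : ℤ, |z| ≤ n ∧ ∀ i, S₁.F i ((S₁.s ^ z) x) = S₁.F i c
    · obtain ⟨x, y, hxy, z, hz, hx⟩ := hex2
      obtain ⟨d, h1, h2, h3⟩ : ∃ d, (∀ i, S₂.F i d = d' i) ∧ ¬ S₂.Q d ∧ d ≠ (S₂.s ^ z) y := by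
        by_cases h : p = (S₂.s ^ z) y
        · exact ⟨q, fun i => (hF i).trans (hpF i), hqQ, by rw [← h]; exact hpq.symm⟩
        · exact ⟨p, hpF, hpQ, h⟩
      refine ⟨d, h1, h2, ?_⟩
      rintro x' y' hxy' z' hz' rfl
      have h5 := (horb x' y' hxy' z' hz').2 h1
      have h6 := S₁.fib2 (x := c) hQ hx h5 (hex x y hxy z hz).symm (hex x' y' hxy' z' hz').symm
      apply h3
      rw [S₂.zEq]
      rw [eq_comm, S₁.zEq] at h6
      refine (hR.good _ hxy' _ hxy _ ?_).2.1.1 h6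
      have := abs_sub z' z
      push_cast; lia
    · push Not at hex2
      refine ⟨p, hpF, hpQ, ?_⟩
      rintro x y hxy z hz rfl
      obtain ⟨i, hi⟩ := hex2 x y hxy z hz
      exact hi ((horb x y hxy z hz).2 hpF i)
  obtain ⟨d, hdF, hdQ, hdne⟩ := hd
  refine ⟨d, hdF, ?_⟩
  have hcE : S₁.E c (S₁.F false c) := S₁.symm (S₁.FE _ _)
  have hdE : S₂.E d (d' false) := by rw [← hdF]; exact S₂.symm (S₂.FE _ _)
  apply Good.insert (hR.good.mono (by omega))
  · intro x y hxy z hz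
    refine ⟨?_, ?_, ?_⟩
    · rw [S₁.congr ((S₁.zE z).2 hcE) (S₁.refl x), S₂.congr ((S₂.zE z).2 hdE) (S₂.refl y)]
      exact (hR.good _ (hd' false) _ hxy z (by push_cast; lia)).1
    · refine iff_of_false ?_ ?_
      · intro h
        apply hex x y hxy (-z) (by simpa using hz)
        rw [← h]; simp
      · intro h
        apply hdne x y hxy (-z) (by simpa using hz)
        rw [← h]; simp
    · intro t ht
      refine ⟨iff_of_false ?_ ?_, iff_of_false ?_ ?_⟩
      · exact fun h => hQ ((S₁.zQ z).1 (Sys.P_prop h).1)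
      · exact fun h => hdQ ((S₂.zQ z).1 (Sys.P_prop h).1)
      · exact fun h => hQ (Sys.P_prop h).2.1
      · exact fun h => hdQ (Sys.P_prop h).2.1
  · intro z hz
    refine ⟨?_, ?_, ?_⟩
    · rw [S₁.congr ((S₁.zE z).2 hcE) hcE, S₂.congr ((S₂.zE z).2 hdE) hdE]
      exact (hR.good _ (hd' false) _ (hd' false) z (by push_cast; lia)).1
    · rw [S₁.P_all hQ, S₂.P_all hdQ, hdF, hdF]
      have := (hR.good _ (hd' false) _ (hd' true) 0 (by simp)).2.2 z (by push_cast; lia)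
      simpa using this
    · intro t ht
      refine iff_of_false ?_ ?_
      · exact fun h => hQ (Sys.P_prop h).2.1
      · exact fun h => hdQ (Sys.P_prop h).2.1

def Nn (m : ℕ) : ℕ := m * m + 4 * m

theorem BF.insertQ {n : ℕ} {R : Set (N₁ × N₂)} (hfin : R.Finite)
    (hcl : ∀ p ∈ R, ∀ i, (S₁.F i p.1, S₂.F i p.2) ∈ R) {c : N₁} {d : N₂}
    (hc : ∀ i, (S₁.F i c, S₂.F i d) ∈ insert (c, d) R)
    (hg : Good S₁ S₂ n (insert (c, d) R)) : BF S₁ S₂ n (insert (c, d) R) := by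
  refine ⟨hfin.insert _, ?_, hg⟩
  rintro p (rfl | hp) i
  · exact hc i
  · exact Or.inr (hcl p hp i)

theorem extstep {n : ℕ} (hG1 : Gen S₂.E S₂.F S₂.s (3 * n)) (hG2 : Gen S₂.E S₂.F S₂.s (Nn (3 * n)))
    {R : Set (N₁ × N₂)} (hR : BF S₁ S₂ (Nn (Nn (3 * n))) R) (c : N₁) :
    ∃ d R', R ⊆ R' ∧ (c, d) ∈ R' ∧ BF S₁ S₂ n R' := by
  obtain ⟨d1, hd1, hg1⟩ := qstep hG2 hR (S₁.F false c) (S₁.QF _ _)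
  have hR1 : BF S₁ S₂ (Nn (3 * n)) (insert (S₁.F false c, d1) R) := BF.insertQ hR.fin hR.cl (by
    intro i; left; rw [S₁.FF, hd1.F]) hg1
  obtain ⟨d2, hd2, hg2⟩ := qstep hG1 hR1 (S₁.F true c) (S₁.QF _ _)
  have hR2 := BF.insertQ hR1.fin hR1.cl (by
    intro i; left; rw [S₁.FF, hd2.F]) hg2
  by_cases hQ : S₁.Q c
  · refine ⟨d1, _, ?_, ?_, hR2.mono (by omega)⟩
    · exact fun p hp => Or.inr (Or.inr hp)
    · right; left
      rw [hQ.F]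
  · obtain ⟨d, hdF, hd⟩ := fibstep hR2 hQ (d' := fun i => if i then d2 else d1) (by
      intro i; cases i
      · right; left; simp
      · left; simp)
    refine ⟨d, _, ?_, Or.inl rfl, BF.insertQ hR2.fin hR2.cl ?_ hd⟩
    · exact fun p hp => Or.inr (Or.inr (Or.inr hp))
    · intro i
      rw [hdF]
      cases i
      · right; right; left; simp
      · right; left; simp

/-- Back-and-forth extension property (one direction). -/
def Ext (S₁ : Sys N₁) (S₂ : Sys N₂) : Prop :=
  ∀ n, ∃ m, ∀ R, BF S₁ S₂ m R → ∀ c, ∃ d R', R ⊆ R' ∧ (c, d) ∈ R' ∧ BF S₁ S₂ n R'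

theorem ext_of_gen (hG : ∀ n, Gen S₂.E S₂.F S₂.s n) : Ext S₁ S₂ :=
  fun _ => ⟨_, fun _ hR c => extstep (hG _) (hG _) hR c⟩

theorem ext_of_one (hG : Gen S₂.E S₂.F S₂.s 0) (h1 : S₁.s = 1) (h2 : S₂.s = 1) : Ext S₁ S₂ := by
  intro n
  refine ⟨0, fun R hR c => ?_⟩
  obtain ⟨d, R', h3, h4, h5⟩ := extstep (n := 0) hG hG hR c
  refine ⟨d, R', h3, h4, h5.fin, h5.cl, ?_⟩
  intro p hp q hq z hz
  have := h5.good p hp q hq 0 (by simp)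
  simp only [h1, h2, one_zpow, Sys.P] at this ⊢
  exact ⟨this.1, this.2.1, fun t _ => this.2.2 0 (by simp)⟩

end

/-- Description of the symbols of a language in terms of the operations of a system. -/
class Desc (L : Language.{0, 0}) where
  fd : ∀ {n}, L.Functions n → Fin n × Option Bool
  rd : ∀ {n}, L.Relations n → Fin n × Option (Fin n)

structure Interp (L : Language.{0, 0}) [Desc L] {N : Type u} [L.Structure N] (S : Sys N) : Prop where
  fn : ∀ {n} (f : L.Functions n) (x : Fin n → N), funMap f x =
    match (Desc.fd f).2 with
    | none => S.s (x (Desc.fd f).1)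
    | some i => S.F i (x (Desc.fd f).1)
  rl : ∀ {n} (r : L.Relations n) (x : Fin n → N), RelMap r x ↔
    match (Desc.rd r).2 with
    | none => S.Q (x (Desc.rd r).1)
    | some i => S.E (x (Desc.rd r).1) (x i)

def Sys.G {N : Type u} (S : Sys N) : Option Bool → N → N
  | none => id
  | some i => S.F i

theorem term_nf {L : Language.{0, 0}} [Desc L] {β : Type w} (t : L.Term β) :
    ∃ (b : β) (m : ℕ) (g : Option Bool), ∀ (N : Type u) [L.Structure N] (S : Sys N), Interp L S →
      ∀ v : β → N, t.realize v = (S.s ^ (m : ℤ)) (S.G g (v b)) := by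
  induction t with
  | var b => exact ⟨b, 0, none, fun N _ S _ v => by simp [Sys.G]⟩
  | @func l f ts ih =>
    obtain ⟨b, m, g, h⟩ := ih (Desc.fd f).1
    cases hfd : (Desc.fd f).2 with
    | none =>
      refine ⟨b, m + 1, g, fun N _ S hI v => ?_⟩
      rw [Term.realize_func, hI.fn, hfd]
      simp only
      rw [h N S hI v]
      push_cast
      rw [add_comm, S.zadd, zpow_one]
    | some i =>
      refine ⟨b, m, some (g.getD i), fun N _ S hI v => ?_⟩
      rw [Term.realize_func, hI.fn, hfd]
      simp only
      rw [h N S hI v, S.zF]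
      cases g with
      | none => rfl
      | some j => simp [Sys.G, S.FF]

theorem ef {L : Language.{0, 0}} [Desc L] {N₁ N₂ : Type u} [L.Structure N₁] [L.Structure N₂]
    {S₁ : Sys N₁} {S₂ : Sys N₂} (h₁ : Interp L S₁) (h₂ : Interp L S₂) (e₁ : Ext S₁ S₂) (e₂ : Ext S₂ S₁)
    {α : Type w} {n : ℕ} (φ : L.BoundedFormula α n) :
    ∃ (K : ℕ) (A : Set α), A.Finite ∧ ∀ (v₁ : α → N₁) (v₂ : α → N₂) (xs₁ : Fin n → N₁) (xs₂ : Fin n → N₂)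
      (R : Set (N₁ × N₂)), BF S₁ S₂ K R → (∀ a ∈ A, (v₁ a, v₂ a) ∈ R) → (∀ i, (xs₁ i, xs₂ i) ∈ R) →
      (φ.Realize v₁ xs₁ ↔ φ.Realize v₂ xs₂) := by
  have key : ∀ {n : ℕ} (b : α ⊕ Fin n) (g : Option Bool) {v₁ : α → N₁} {v₂ : α → N₂} {xs₁ : Fin n → N₁}
      {xs₂ : Fin n → N₂} {R : Set (N₁ × N₂)} {K}, BF S₁ S₂ K R → (∀ a, b = Sum.inl a → (v₁ a, v₂ a) ∈ R) →
      (∀ i, (xs₁ i, xs₂ i) ∈ R) → (S₁.G g (Sum.elim v₁ xs₁ b), S₂.G g (Sum.elim v₂ xs₂ b)) ∈ R := by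
    intro n b g v₁ v₂ xs₁ xs₂ R K hR h1 h2
    have : (Sum.elim v₁ xs₁ b, Sum.elim v₂ xs₂ b) ∈ R := by
      cases b with
      | inl a => exact h1 a rfl
      | inr i => exact h2 i
    cases g with
    | none => exact this
    | some i => exact hR.cl _ this i
  have hfinA : ∀ {n} (b : α ⊕ Fin n), {a | b = Sum.inl a}.Finite := by
    intro n b
    apply Set.Subsingleton.finite
    intro x hx y hy
    exact Sum.inl_injective (hx.symm.trans hy)
  have hb : ∀ m m' : ℕ, |(m : ℤ) - m'| ≤ ((m + m' : ℕ) : ℤ) := by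
    intro m m'; rw [abs_le]; push_cast; constructor <;> omega
  induction φ with
  | falsum => exact ⟨0, ∅, Set.finite_empty, fun _ _ _ _ _ _ _ _ => Iff.rfl⟩
  | equal t₁ t₂ =>
    obtain ⟨b, m, g, h⟩ := term_nf t₁
    obtain ⟨b', m', g', h'⟩ := term_nf t₂
    refine ⟨m + m', {a | b = Sum.inl a} ∪ {a | b' = Sum.inl a}, (hfinA b).union (hfinA b'), ?_⟩
    intro v₁ v₂ xs₁ xs₂ R hR hv hx
    simp only [BoundedFormula.Realize]
    rw [h N₁ S₁ h₁, h N₂ S₂ h₂, h' N₁ S₁ h₁, h' N₂ S₂ h₂, S₁.zEq, S₂.zEq]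
    exact (hR.good _ (key b g hR (fun a ha => hv a (Or.inl ha)) hx) _
      (key b' g' hR (fun a ha => hv a (Or.inr ha)) hx) _ (hb _ _)).2.1
  | @rel n l r ts =>
    obtain ⟨b, m, g, h⟩ := term_nf (ts (Desc.rd r).1)
    cases hrd : (Desc.rd r).2 with
    | none =>
      refine ⟨m, {a | b = Sum.inl a}, hfinA b, ?_⟩
      intro v₁ v₂ xs₁ xs₂ R hR hv hx
      simp only [BoundedFormula.Realize]
      rw [h₁.rl, h₂.rl, hrd]
      simp only
      rw [h N₁ S₁ h₁, h N₂ S₂ h₂, S₁.zQ, S₂.zQ]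
      exact hR.Q (key b g hR (fun a ha => hv a ha) hx)
    | some i =>
      obtain ⟨b', m', g', h'⟩ := term_nf (ts i)
      refine ⟨m + m', {a | b = Sum.inl a} ∪ {a | b' = Sum.inl a}, (hfinA b).union (hfinA b'), ?_⟩
      intro v₁ v₂ xs₁ xs₂ R hR hv hx
      simp only [BoundedFormula.Realize]
      rw [h₁.rl, h₂.rl, hrd]
      simp only
      rw [h N₁ S₁ h₁, h N₂ S₂ h₂, h' N₁ S₁ h₁, h' N₂ S₂ h₂, S₁.zE', S₂.zE']
      exact (hR.good _ (key b g hR (fun a ha => hv a (Or.inl ha)) hx) _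
        (key b' g' hR (fun a ha => hv a (Or.inr ha)) hx) _ (hb _ _)).1
  | imp φ ψ ih1 ih2 =>
    obtain ⟨K, A, hA, h⟩ := ih1
    obtain ⟨K', A', hA', h'⟩ := ih2
    refine ⟨max K K', A ∪ A', hA.union hA', ?_⟩
    intro v₁ v₂ xs₁ xs₂ R hR hv hx
    simp only [BoundedFormula.realize_imp]
    rw [h v₁ v₂ xs₁ xs₂ R (hR.mono (le_max_left _ _)) (fun a ha => hv a (Or.inl ha)) hx,
      h' v₁ v₂ xs₁ xs₂ R (hR.mono (le_max_right _ _)) (fun a ha => hv a (Or.inr ha)) hx]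
  | all φ ih =>
    obtain ⟨K, A, hA, h⟩ := ih
    obtain ⟨K₁, hK₁⟩ := e₁ K
    obtain ⟨K₂, hK₂⟩ := e₂ K
    refine ⟨max K₁ K₂, A, hA, ?_⟩
    intro v₁ v₂ xs₁ xs₂ R hR hv hx
    simp only [BoundedFormula.realize_all]
    constructor
    · intro H d
      obtain ⟨c, R', h1, h2, h3⟩ := hK₂ _ (hR.mono (le_max_right _ _)).swap d
      have h3' := h3.swap
      refine (h v₁ v₂ (Fin.snoc xs₁ c) (Fin.snoc xs₂ d) _ h3' (fun a ha => ?_) (fun i => ?_)).1 (H c)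
      · exact h1 (hv a ha)
      · refine Fin.lastCases ?_ (fun i => ?_) i
        · simpa using h2
        · simpa using h1 (hx i)
    · intro H c
      obtain ⟨d, R', h1, h2, h3⟩ := hK₁ _ (hR.mono (le_max_left _ _)) c
      refine (h v₁ v₂ (Fin.snoc xs₁ c) (Fin.snoc xs₂ d) _ h3 (fun a ha => ?_) (fun i => ?_)).2 (H d)
      · exact h1 (hv a ha)
      · refine Fin.lastCases ?_ (fun i => ?_) i
        · simpa using h2
        · simpa using h1 (hx i)


section Df
variable {L : Language.{0, 0}} {α : Type}

/-- Uniformly definable predicates. -/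
def Df (L : Language.{0, 0}) (α : Type)
    (P : ∀ (N : Type u) [L.Structure N], (α → N) → Prop) : Prop :=
  ∃ φ : L.Formula α, ∀ (N : Type u) [L.Structure N] (v : α → N), φ.Realize v ↔ P N v

/-- Uniformly definable terms. -/
def Dt (L : Language.{0, 0}) (α : Type)
    (s : ∀ (N : Type u) [L.Structure N], (α → N) → N) : Prop :=
  ∃ t : L.Term α, ∀ (N : Type u) [L.Structure N] (v : α → N), t.realize v = s N v

theorem Dt.var (a : α) : Dt.{u} L α (fun _ _ v => v a) := ⟨Term.var a, fun _ _ _ => rfl⟩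

theorem Dt.app {s : ∀ (N : Type u) [L.Structure N], (α → N) → N} (f : L.Functions 1)
    (hs : Dt.{u} L α s) : Dt.{u} L α (fun N _ v => funMap f ![s N v]) := by
  obtain ⟨t, ht⟩ := hs
  exact ⟨f.apply₁ t, fun N _ v => by rw [Term.realize_functions_apply₁, ht]⟩

theorem Df.eq {s t : ∀ (N : Type u) [L.Structure N], (α → N) → N} (hs : Dt.{u} L α s)
    (ht : Dt.{u} L α t) : Df.{u} L α (fun N _ v => s N v = t N v) := by
  obtain ⟨s', hs⟩ := hs
  obtain ⟨t', ht⟩ := ht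
  exact ⟨s'.equal t', fun N _ v => by rw [Formula.realize_equal, hs, ht]⟩

theorem Df.rel₁ {s : ∀ (N : Type u) [L.Structure N], (α → N) → N} (r : L.Relations 1)
    (hs : Dt.{u} L α s) : Df.{u} L α (fun N _ v => RelMap r ![s N v]) := by
  obtain ⟨s', hs⟩ := hs
  exact ⟨r.formula₁ s', fun N _ v => by rw [Formula.realize_rel₁, hs]⟩

theorem Df.rel₂ {s t : ∀ (N : Type u) [L.Structure N], (α → N) → N} (r : L.Relations 2)
    (hs : Dt.{u} L α s) (ht : Dt.{u} L α t) :
    Df.{u} L α (fun N _ v => RelMap r ![s N v, t N v]) := by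
  obtain ⟨s', hs⟩ := hs
  obtain ⟨t', ht⟩ := ht
  exact ⟨r.formula₂ s' t', fun N _ v => by rw [Formula.realize_rel₂, hs, ht]⟩

theorem Df.const (p : Prop) : Df.{u} L α (fun _ _ _ => p) := by
  by_cases h : p
  · exact ⟨⊤, fun N _ v => by simp [h]⟩
  · exact ⟨⊥, fun N _ v => by simp [h]⟩

variable {P P' : ∀ (N : Type u) [L.Structure N], (α → N) → Prop}

theorem Df.imp (h : Df.{u} L α P) (h' : Df.{u} L α P') :
    Df.{u} L α (fun N _ v => P N v → P' N v) := by
  obtain ⟨φ, h⟩ := h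
  obtain ⟨φ', h'⟩ := h'
  exact ⟨φ.imp φ', fun N _ v => by rw [Formula.realize_imp, h, h']⟩

theorem Df.not (h : Df.{u} L α P) : Df.{u} L α (fun N _ v => ¬ P N v) := by
  obtain ⟨φ, h⟩ := h
  exact ⟨φ.not, fun N _ v => by rw [Formula.realize_not, h]⟩

theorem Df.and (h : Df.{u} L α P) (h' : Df.{u} L α P') :
    Df.{u} L α (fun N _ v => P N v ∧ P' N v) := by
  obtain ⟨φ, h⟩ := h
  obtain ⟨φ', h'⟩ := h'
  exact ⟨φ ⊓ φ', fun N _ v => by rw [Formula.realize_inf, h, h']⟩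

theorem Df.or (h : Df.{u} L α P) (h' : Df.{u} L α P') :
    Df.{u} L α (fun N _ v => P N v ∨ P' N v) := by
  obtain ⟨φ, h⟩ := h
  obtain ⟨φ', h'⟩ := h'
  exact ⟨φ ⊔ φ', fun N _ v => by rw [Formula.realize_sup, h, h']⟩

theorem Df.iff (h : Df.{u} L α P) (h' : Df.{u} L α P') :
    Df.{u} L α (fun N _ v => P N v ↔ P' N v) := by
  obtain ⟨φ, h⟩ := h
  obtain ⟨φ', h'⟩ := h'
  exact ⟨φ.iff φ', fun N _ v => by rw [Formula.realize_iff, h, h']⟩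

theorem Df.all {B : ∀ (N : Type u) [L.Structure N], (α → N) → N → Prop}
    (h : Df.{u} L (α ⊕ Unit) (fun N _ v => B N (fun a => v (Sum.inl a)) (v (Sum.inr ())))) :
    Df.{u} L α (fun N _ v => ∀ x, B N v x) := by
  obtain ⟨φ, h⟩ := h
  refine ⟨φ.iAlls Unit, fun N _ v => ?_⟩
  rw [Formula.realize_iAlls]
  simp only [h, Sum.elim_inl, Sum.elim_inr]
  exact ⟨fun H x => H (fun _ => x), fun H i => H _⟩

theorem Df.ex {B : ∀ (N : Type u) [L.Structure N], (α → N) → N → Prop}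
    (h : Df.{u} L (α ⊕ Unit) (fun N _ v => B N (fun a => v (Sum.inl a)) (v (Sum.inr ())))) :
    Df.{u} L α (fun N _ v => ∃ x, B N v x) := by
  obtain ⟨φ, h⟩ := h
  refine ⟨φ.iExs Unit, fun N _ v => ?_⟩
  rw [Formula.realize_iExs]
  simp only [h, Sum.elim_inl, Sum.elim_inr]
  exact ⟨fun ⟨i, H⟩ => ⟨_, H⟩, fun ⟨x, H⟩ => ⟨fun _ => x, H⟩⟩

theorem Df.alls {k : ℕ} {B : ∀ (N : Type u) [L.Structure N], (α → N) → (Fin k → N) → Prop}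
    (h : Df.{u} L (α ⊕ Fin k) (fun N _ v => B N (fun a => v (Sum.inl a)) (fun i => v (Sum.inr i)))) :
    Df.{u} L α (fun N _ v => ∀ x, B N v x) := by
  obtain ⟨φ, h⟩ := h
  refine ⟨φ.iAlls (Fin k), fun N _ v => ?_⟩
  rw [Formula.realize_iAlls]
  simp only [h, Sum.elim_inl, Sum.elim_inr]

theorem Df.fin {β : Type} [Finite β] {B : β → ∀ (N : Type u) [L.Structure N], (α → N) → Prop}
    (h : ∀ i, Df.{u} L α (B i)) : Df.{u} L α (fun N _ v => ∀ i, B i N v) := by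
  choose φ h using h
  refine ⟨Formula.iInf φ, fun N _ v => ?_⟩
  rw [Formula.realize_iInf]
  simp only [h]

theorem Df.lt {k : ℕ} {B : ℕ → ∀ (N : Type u) [L.Structure N], (α → N) → Prop}
    (h : ∀ i, Df.{u} L α (B i)) : Df.{u} L α (fun N _ v => ∀ i < k, B i N v) := by
  obtain ⟨φ, h⟩ := Df.fin (β := Fin k) (fun i => h i)
  refine ⟨φ, fun N _ v => (h N v).trans ⟨fun H i hi => H ⟨i, hi⟩, fun H i => H i i.2⟩⟩

theorem Df.le {k : ℕ} {B : ℕ → ∀ (N : Type u) [L.Structure N], (α → N) → Prop}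
    (h : ∀ i, Df.{u} L α (B i)) : Df.{u} L α (fun N _ v => ∀ i ≤ k, B i N v) := by
  obtain ⟨φ, h⟩ := Df.lt (k := k + 1) h
  refine ⟨φ, fun N _ v => (h N v).trans ⟨fun H i hi => H i (by omega), fun H i hi => H i (by omega)⟩⟩

end Df

/-! The operations of structures -/

def fsym : Bool → L2.Functions 1
  | false => L0Func.F₁
  | true => L0Func.F₂

def E2 (N : Type u) [L2.Structure N] (x y : N) : Prop := RelMap (L := L2) L2Rel.E ![x, y]
def Q2 (N : Type u) [L2.Structure N] (x : N) : Prop := RelMap (L := L2) L2Rel.Q ![x]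
def F2 (N : Type u) [L2.Structure N] (i : Bool) (x : N) : N := funMap (fsym i) ![x]

def EP (N : Type u) [(LPlus L2).Structure N] (x y : N) : Prop :=
  RelMap (L := LPlus L2) (Sum.inl L2Rel.E) ![x, y]
def QP (N : Type u) [(LPlus L2).Structure N] (x : N) : Prop :=
  RelMap (L := LPlus L2) (Sum.inl L2Rel.Q) ![x]
def FP (N : Type u) [(LPlus L2).Structure N] (i : Bool) (x : N) : N :=
  funMap (L := LPlus L2) (Sum.inl (fsym i)) ![x]

structure Bas {N : Type u} (E : N → N → Prop) (Q : N → Prop) (F : Bool → N → N) : Prop where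
  refl : ∀ x, E x x
  symm : ∀ x y, E x y → E y x
  trans : ∀ x y z, E x y → E y z → E x z
  FE : ∀ i x, E (F i x) x
  FF : ∀ i j x, F i (F j x) = F j x
  Finj : ∀ x, F false x = F true x → F false x = x
  fib : ∀ a b, F false a = a → F false b = b → E a b → ¬ a = b →
    ∃ x y, ¬ x = y ∧ F false x = a ∧ F true x = b ∧ F false y = a ∧ F true y = b ∧
      ∀ z, F false z = a → F true z = b → z = x ∨ z = y
  Q : ∀ x, Q x ↔ F false x = x

section
variable {α : Type}

theorem Df.E2 {s t : ∀ (N : Type u) [L2.Structure N], (α → N) → N}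
    (hs : Dt.{u} L2 α s) (ht : Dt.{u} L2 α t) :
    Df.{u} L2 α (fun N _ v => E2 N (s N v) (t N v)) := Df.rel₂ (L := L2) L2Rel.E hs ht
theorem Df.Q2 {s : ∀ (N : Type u) [L2.Structure N], (α → N) → N}
    (hs : Dt.{u} L2 α s) :
    Df.{u} L2 α (fun N _ v => Q2 N (s N v)) := Df.rel₁ (L := L2) L2Rel.Q hs
theorem Dt.F2 {s : ∀ (N : Type u) [L2.Structure N], (α → N) → N} (i : Bool)
    (hs : Dt.{u} L2 α s) : Dt.{u} L2 α (fun N _ v => F2 N i (s N v)) := Dt.app (fsym i) hs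

theorem Df.EP {s t : ∀ (N : Type u) [(LPlus L2).Structure N], (α → N) → N}
    (hs : Dt.{u} (LPlus L2) α s) (ht : Dt.{u} (LPlus L2) α t) :
    Df.{u} (LPlus L2) α (fun N _ v => EP N (s N v) (t N v)) :=
  Df.rel₂ (L := LPlus L2) (Sum.inl L2Rel.E) hs ht
theorem Dt.FP {s : ∀ (N : Type u) [(LPlus L2).Structure N], (α → N) → N} (i : Bool)
    (hs : Dt.{u} (LPlus L2) α s) : Dt.{u} (LPlus L2) α (fun N _ v => FP N i (s N v)) :=
  Dt.app (L := LPlus L2) (Sum.inl (fsym i)) hs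
theorem Dt.σ {s : ∀ (N : Type u) [(LPlus L2).Structure N], (α → N) → N}
    (hs : Dt.{u} (LPlus L2) α s) : Dt.{u} (LPlus L2) α (fun N _ v => sigmaMap L2 N (s N v)) :=
  Dt.app (sigmaSymb L2) hs
theorem Dt.it {s : ∀ (N : Type u) [(LPlus L2).Structure N], (α → N) → N} (k : ℕ)
    (hs : Dt.{u} (LPlus L2) α s) :
    Dt.{u} (LPlus L2) α (fun N _ v => (sigmaMap L2 N)^[k] (s N v)) := by
  induction k with
  | zero => exact hs
  | succ k ih =>
    simp only [Function.iterate_succ_apply']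
    exact Dt.σ ih

theorem Df.PN {s t : ∀ (N : Type u) [(LPlus L2).Structure N], (α → N) → N} (k : ℕ)
    (hs : Dt.{u} (LPlus L2) α s) (ht : Dt.{u} (LPlus L2) α t) :
    Df.{u} (LPlus L2) α (fun N _ v => PN (ShelahE34.FP N) (sigmaMap L2 N) k (s N v) (t N v)) := by
  unfold ShelahE34.PN
  have lift : ∀ {s : ∀ (N : Type u) [(LPlus L2).Structure N], (α → N) → N},
      Dt.{u} (LPlus L2) α s → Dt.{u} (LPlus L2) (α ⊕ Unit) (fun N _ v => s N (fun a => v (Sum.inl a))) := by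
    rintro s ⟨t, ht⟩
    refine ⟨t.relabel Sum.inl, fun N _ v => ?_⟩
    rw [Term.realize_relabel, ht]; rfl
  refine Df.ex (Df.and (Df.not (Df.eq (.FP _ (.var _)) (.var _))) (.and (.eq (.FP _ (.var _)) (lift hs))
    (.and (.eq (.FP _ (.var _)) (lift ht)) (.eq (.it _ (.var _)) (.var _)))))

theorem exists_sentence {L : Language.{0, 0}} {X : ∀ (N : Type u) [L.Structure N], Prop}
    (h : Df.{u} L Empty (fun N _ _ => X N)) :
    ∃ φ : L.Sentence, ∀ (N : Type u) [L.Structure N], N ⊨ φ ↔ X N := by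
  obtain ⟨φ, h⟩ := h
  exact ⟨φ, fun N _ => h N _⟩

theorem Bas_df {α : Type} : Df.{u} L2 α (fun N _ _ => Bas (E2 N) (Q2 N) (F2 N)) := by
  have : ∀ (N : Type u) [L2.Structure N], Bas (E2 N) (Q2 N) (F2 N) ↔ (_ ∧ _ ∧ _ ∧ _ ∧ _ ∧ _ ∧ _ ∧ _) :=
    fun N _ => ⟨fun h => ⟨h.refl, h.symm, h.trans, h.FE, h.FF, h.Finj, h.fib, h.Q⟩,
      fun ⟨a, b, c, d, e, f, g, h⟩ => ⟨a, b, c, d, e, f, g, h⟩⟩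
  simp only [this]
  refine .and ?_ (.and ?_ (.and ?_ (.and ?_ (.and ?_ (.and ?_ (.and ?_ ?_))))))
  · exact .all (.E2 (.var _) (.var _))
  · exact .all (.all (.imp (.E2 (.var _) (.var _)) (.E2 (.var _) (.var _))))
  · exact .all (.all (.all (.imp (.E2 (.var _) (.var _)) (.imp (.E2 (.var _) (.var _)) (.E2 (.var _) (.var _))))))
  · exact .fin (fun i => .all (.E2 (.F2 _ (.var _)) (.var _)))
  · exact .fin (fun i => .fin fun j => .all (.eq (.F2 _ (.F2 _ (.var _))) (.F2 _ (.var _))))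
  · exact .all (.imp (.eq (.F2 _ (.var _)) (.F2 _ (.var _))) (.eq (.F2 _ (.var _)) (.var _)))
  · refine .all (.all (.imp (.eq (.F2 _ (.var _)) (.var _)) (.imp (.eq (.F2 _ (.var _)) (.var _))
      (.imp (.E2 (.var _) (.var _)) (.imp (.not (.eq (.var _) (.var _))) (.ex (.ex ?_)))))))
    refine .and (.not (.eq (.var _) (.var _))) (.and (.eq (.F2 _ (.var _)) (.var _))
      (.and (.eq (.F2 _ (.var _)) (.var _)) (.and (.eq (.F2 _ (.var _)) (.var _))
      (.and (.eq (.F2 _ (.var _)) (.var _)) (.all ?_)))))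
    exact .imp (.eq (.F2 _ (.var _)) (.var _)) (.imp (.eq (.F2 _ (.var _)) (.var _))
      (.or (.eq (.var _) (.var _)) (.eq (.var _) (.var _))))
  · exact .all (.iff (.Q2 (.var _)) (.eq (.F2 _ (.var _)) (.var _)))

theorem g1_df {α : Type} (r k : ℕ) : Df.{u} (LPlus L2) α (fun N _ _ => ∀ v : Fin k → N,
    ∃ x, EP N ((sigmaMap L2 N)^[r] x) x ∧
    (∀ i < r, 0 < i → ¬ EP N ((sigmaMap L2 N)^[i] x) x) ∧ ∀ i, ¬ EP N x (v i)) := by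
  refine .alls (.ex (.and (.EP (.it _ (.var _)) (.var _)) (.and (.lt fun i => .imp (.const _) ?_) (.fin fun i => ?_))))
  · exact .not (.EP (.it _ (.var _)) (.var _))
  · exact .not (.EP (.var _) (.var _))

theorem g3_df {α : Type} (n k : ℕ) : Df.{u} (LPlus L2) α (fun N _ _ => ∀ (x : N) (v : Fin k → N),
    ∃ d, FP N false d = d ∧ EP N d x ∧
    (∀ i ≤ n, 0 < i → ¬ (sigmaMap L2 N)^[i] d = d) ∧ ∀ i, ¬ d = v i) := by
  refine .all (.alls (.ex (.and (.eq (.FP _ (.var _)) (.var _)) (.and (.EP (.var _) (.var _))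
    (.and (.le fun i => .imp (.const _) ?_) (.fin fun i => ?_))))))
  · exact .not (.eq (.it _ (.var _)) (.var _))
  · exact .not (.eq (.var _) (.var _))

theorem g2_df {α : Type} (n r k : ℕ) (e f : Fin k → Prop) (w : ℕ → Prop) :
    Df.{u} (LPlus L2) α (fun N _ _ => ∀ (x : N) (v : Fin k → N),
    EP N ((sigmaMap L2 N)^[r] x) x →
    (∀ i j, ∀ q ≤ n, (sigmaMap L2 N)^[r * q] (v i) = v j → (e i ↔ e j) ∧ (f i ↔ f j)) →
    ∃ d, FP N false d = d ∧ EP N d x ∧ (sigmaMap L2 N)^[r] d = d ∧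
      (∀ i < r, 0 < i → ¬ (sigmaMap L2 N)^[i] d = d) ∧
      (∀ i, ¬ d = v i) ∧
      (∀ i, FP N false (v i) = v i → EP N (v i) x → ∀ q ≤ n, 0 < q → (sigmaMap L2 N)^[r * q] (v i) = v i →
        (∀ q' < q, 0 < q' → ¬ (sigmaMap L2 N)^[r * q'] (v i) = v i) →
        (PN (FP N) (sigmaMap L2 N) (r * q) d (v i) ↔ e i) ∧
        (PN (FP N) (sigmaMap L2 N) (r * q) (v i) d ↔ f i)) ∧
      ∀ j < r, 0 < j → EP N ((sigmaMap L2 N)^[j] d) d →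
        (PN (FP N) (sigmaMap L2 N) r d ((sigmaMap L2 N)^[j] d) ↔ w j)) := by
  refine .all (.alls (.imp (.EP (.it _ (.var _)) (.var _)) (.imp (.fin fun i => .fin fun j => .le fun q =>
    .imp (.eq (.it _ (.var _)) (.var _)) (.const _)) (.ex ?_))))
  refine .and (.eq (.FP _ (.var _)) (.var _)) (.and (.EP (.var _) (.var _))
    (.and (.eq (.it _ (.var _)) (.var _)) (.and (.lt fun i => .imp (.const _)
    (.not (.eq (.it _ (.var _)) (.var _)))) (.and (.fin fun i => .not (.eq (.var _) (.var _)))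
    (.and (.fin fun i => ?_) (.lt fun j => ?_))))))
  · refine .imp (.eq (.FP _ (.var _)) (.var _)) (.imp (.EP (.var _) (.var _)) (.le fun q => .imp (.const _)
      (.imp (.eq (.it _ (.var _)) (.var _)) (.imp (.lt fun q' => .imp (.const _)
      (.not (.eq (.it _ (.var _)) (.var _)))) (.and (.iff (.PN _ (.var _) (.var _)) (.const _))
        (.iff (.PN _ (.var _) (.var _)) (.const _)))))))
  · exact .imp (.const _) (.imp (.EP (.it _ (.var _)) (.var _)) (.iff (.PN _ (.var _) (.it _ (.var _))) (.const _)))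

end

def fdesc : ∀ {n}, L0Func n → Fin n × Option Bool
  | _, .F₁ => (0, some false)
  | _, .F₂ => (0, some true)
def rdesc : ∀ {n}, L2Rel n → Fin n × Option (Fin n)
  | _, .Q => (0, none)
  | _, .E => (0, some 1)
def sdesc : ∀ {n}, SigmaFunc n → Fin n × Option Bool
  | _, .sigma => (0, none)

instance : Desc L2 where
  fd f := fdesc f
  rd r := rdesc r

instance : Desc (LPlus L2) where
  fd f := Sum.elim (fun g : L0Func _ => fdesc g) (fun g : SigmaFunc _ => sdesc g) f
  rd r := Sum.elim (fun g : L2Rel _ => rdesc g) (fun g : Empty => g.elim) r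

def sys2 (N : Type u) [L2.Structure N] (h : Bas (E2 N) (Q2 N) (F2 N)) : Sys N where
  E := E2 N
  F := F2 N
  s := 1
  refl := h.refl
  symm := h.symm _ _
  trans := h.trans _ _ _
  FE := h.FE
  FF := h.FF
  Finj := h.Finj
  fib := h.fib
  sE := Iff.rfl
  sF _ _ := rfl

theorem vec1 {N : Type u} (x : Fin 1 → N) : x = ![x 0] := by
  funext i; rw [Fin.eq_zero i]; rfl
theorem vec2 {N : Type u} (x : Fin 2 → N) : x = ![x 0, x 1] := by
  funext i; fin_cases i <;> rfl

theorem interp2 (N : Type u) [L2.Structure N] (h : Bas (E2 N) (Q2 N) (F2 N)) :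
    Interp L2 (sys2 N h) where
  fn {n} f x := by
    change L0Func n at f
    cases f
    · exact congrArg (funMap (L := L2) L0Func.F₁) (vec1 x)
    · exact congrArg (funMap (L := L2) L0Func.F₂) (vec1 x)
  rl {n} r x := by
    change L2Rel n at r
    cases r
    · rw [vec1 x]
      exact h.Q (x 0)
    · rw [vec2 x]
      exact Iff.rfl

/-- `σ` is an automorphism. -/
structure IsAut {N : Type u} (E : N → N → Prop) (F : Bool → N → N) (σ : N → N) : Prop where
  bij : Function.Bijective σ
  sE : ∀ x y, E (σ x) (σ y) ↔ E x y
  sF : ∀ i x, F i (σ x) = σ (F i x)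

noncomputable def sysP (N : Type u) [(LPlus L2).Structure N] (h : Bas (EP N) (QP N) (FP N))
    (h' : IsAut (EP N) (FP N) (sigmaMap L2 N)) : Sys N where
  E := EP N
  F := FP N
  s := Equiv.ofBijective _ h'.bij
  refl := h.refl
  symm := h.symm _ _
  trans := h.trans _ _ _
  FE := h.FE
  FF := h.FF
  Finj := h.Finj
  fib := h.fib
  sE := h'.sE _ _
  sF := h'.sF

theorem interpP (N : Type u) [(LPlus L2).Structure N] (h : Bas (EP N) (QP N) (FP N))
    (h' : IsAut (EP N) (FP N) (sigmaMap L2 N)) : Interp (LPlus L2) (sysP N h h') where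
  fn {n} f x := by
    change L0Func n ⊕ SigmaFunc n at f
    rcases f with f | f
    · cases f
      · exact congrArg (funMap (L := LPlus L2) (Sum.inl L0Func.F₁)) (vec1 x)
      · exact congrArg (funMap (L := LPlus L2) (Sum.inl L0Func.F₂)) (vec1 x)
    · cases f
      exact congrArg (funMap (sigmaSymb L2)) (vec1 x)
  rl {n} r x := by
    change L2Rel n ⊕ Empty at r
    rcases r with r | r
    · cases r
      · rw [vec1 x]
        exact h.Q (x 0)
      · rw [vec2 x]
        exact Iff.rfl
    · exact r.elim

/-- The structure `M₀` lifted to the universe `u`. -/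
structure UM : Type u where
  down : MPoint

def umEquiv : MPoint ≃ UM.{u} := ⟨UM.mk, UM.down, fun _ => rfl, fun _ => rfl⟩

instance : L2.Structure UM.{u} := umEquiv.inducedStructure

def umL : MPoint ≃[L2] UM.{u} := umEquiv.inducedStructureEquiv

theorem um_theory : L2.completeTheory UM.{u} = L2.completeTheory MPoint :=
  (umL.toElementaryEmbedding.elementarilyEquivalent).symm

theorem um_E (x y : UM.{u}) : E2 UM x y ↔ x.down.eta = y.down.eta := Iff.rfl
theorem um_Q (x : UM.{u}) : Q2 UM x ↔ x.down.k = x.down.n := Iff.rfl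
theorem um_F (x : UM.{u}) (i : Bool) : F2 UM i x = UM.mk
    ⟨x.down.eta, cond i x.down.n x.down.k, cond i x.down.n x.down.k, false, fun _ => rfl⟩ := by
  cases i <;> rfl

theorem um_ext {x y : UM.{u}} (h1 : x.down.eta = y.down.eta) (h2 : x.down.k = y.down.k)
    (h3 : x.down.n = y.down.n) (h4 : x.down.l = y.down.l) : x = y := by
  obtain ⟨⟨a, b, c, d, e⟩⟩ := x
  obtain ⟨⟨a', b', c', d', e'⟩⟩ := y
  simp only at h1 h2 h3 h4
  subst h1 h2 h3 h4
  rfl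

theorem um_iff {x y : UM.{u}} : x = y ↔ x.down.eta = y.down.eta ∧ x.down.k = y.down.k ∧
    x.down.n = y.down.n ∧ x.down.l = y.down.l :=
  ⟨by rintro rfl; simp, fun h => um_ext h.1 h.2.1 h.2.2.1 h.2.2.2⟩

theorem um_bas : Bas (E2 UM.{u}) (Q2 UM.{u}) (F2 UM.{u}) where
  refl x := rfl
  symm x y h := Eq.symm h
  trans x y z h h' := Eq.trans h h'
  FE i x := by rw [um_E, um_F]
  FF i j x := by simp [um_F]
  Finj x h := by
    obtain ⟨⟨a, b, c, d, e⟩⟩ := x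
    simp [um_F, um_iff] at h ⊢
    exact ⟨h, e h⟩
  Q x := by
    obtain ⟨⟨a, b, c, d, e⟩⟩ := x
    simp [um_F, um_iff, um_Q]
    intro h
    exact e h
  fib a b ha hb hE hab := by
    obtain ⟨⟨a, k, n, l, e⟩⟩ := a
    obtain ⟨⟨a', k', n', l', e'⟩⟩ := b
    rw [um_E] at hE
    simp only [um_F, um_iff, cond_false, true_and, um_E] at ha hb hE hab
    obtain ⟨rfl, rfl⟩ := ha
    obtain ⟨rfl, rfl⟩ := hb
    subst hE
    have hk : k ≠ k' := by rintro rfl; simp at hab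
    refine ⟨⟨⟨a, k, k', false, fun _ => rfl⟩⟩, ⟨⟨a, k, k', true, fun h => (hk h).elim⟩⟩, ?_⟩
    simp only [um_F, um_iff]
    simp
    rintro ⟨⟨_, _, _, l, e⟩⟩
    simp
    rintro rfl rfl - rfl
    simp

theorem gen_id {N : Type u} {E : N → N → Prop} {F : Bool → N → N} {σ : N → N} {n : ℕ} (h : Gen E F σ n)
    (hr : ∀ x, E x x) : Gen E F id 0 where
  g1 := by
    intro r hr1 hr' k v
    obtain rfl : r = 1 := by omega
    obtain ⟨x, h1, h2, h3⟩ := h.g1 1 (by omega) (by omega) k v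
    exact ⟨x, hr x, by intros; omega, h3⟩
  g2 := by intros; omega
  g3 k x v := by
    obtain ⟨d, h1, h2, h3, h4⟩ := h.g3 k x v
    exact ⟨d, h1, h2, by intros; omega, h4⟩

theorem um_gen : Gen (E2 UM.{u}) (F2 UM.{u}) id 0 where
  g1 := by
    intro r hr hr' k v
    obtain rfl : r = 1 := by omega
    have : ∃ η : ℕ → Bool, η ∉ Set.range (fun i => (v i).down.eta) := by
      by_contra! h
      exact Set.infinite_univ ((Set.finite_range _).subset (fun η _ => h η))
    obtain ⟨η, hη⟩ := this
    refine ⟨⟨⟨η, 0, 0, false, fun _ => rfl⟩⟩, ?_, ?_, ?_⟩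
    · simp [um_E]
    · intros; omega
    · intro i h
      exact hη ⟨i, h.symm⟩
  g2 := by intros; omega
  g3 k x v := by
    have : ∃ m : ℕ, m ∉ Set.range (fun i => (v i).down.k) := by
      by_contra! h
      exact Set.infinite_univ ((Set.finite_range _).subset (fun η _ => h η))
    obtain ⟨m, hm⟩ := this
    refine ⟨⟨⟨x.down.eta, m, m, false, fun _ => rfl⟩⟩, ?_, ?_, ?_, ?_⟩
    · simp [um_F]
    · rfl
    · intros; omega
    · intro i h
      exact hm ⟨i, by simp [← h]⟩

theorem model_T0 (N : Type u) [L2.Structure N] (h : Bas (E2 N) (Q2 N) (F2 N))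
    (hG : Gen (E2 N) (F2 N) id 0) : N ⊨ L2.completeTheory MPoint := by
  rw [← um_theory.{u}]
  refine ⟨fun φ hφ => ?_⟩
  have e1 : Ext (sys2 N h) (sys2 UM.{u} um_bas) := ext_of_one um_gen rfl rfl
  have e2 : Ext (sys2 UM.{u} um_bas) (sys2 N h) := ext_of_one hG rfl rfl
  obtain ⟨K, A, -, H⟩ := ef (interp2 N h) (interp2 UM um_bas) e1 e2 φ
  refine (H default default default default ∅ ⟨Set.finite_empty, by simp, by simp [Good]⟩ ?_ ?_).2 hφ
  · intro a; exact a.elim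
  · intro a; exact a.elim0

theorem bas_of_T0 (N : Type u) [L2.Structure N] (h : N ⊨ L2.completeTheory MPoint) :
    Bas (E2 N) (Q2 N) (F2 N) := by
  obtain ⟨φ, hφ⟩ := exists_sentence (Bas_df.{u} (α := Empty))
  rw [← um_theory.{u}] at h
  rw [← hφ]
  exact h.realize_of_mem φ ((hφ UM).2 um_bas)


abbrev T0 : L2.Theory := L2.completeTheory MPoint

theorem real_inj (N : Type u) [(LPlus L2).Structure N] :
    N ⊨ sigmaInj L2 ↔ Function.Injective (sigmaMap L2 N) := by
  simp [sigmaInj, Sentence.Realize, Formula.Realize, sigmaTerm, sigmaMap, Function.Injective, Fin.snoc,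
    Term.realize_functions_apply₁]

theorem real_surj (N : Type u) [(LPlus L2).Structure N] :
    N ⊨ sigmaSurj L2 ↔ Function.Surjective (sigmaMap L2 N) := by
  simp [sigmaSurj, Sentence.Realize, Formula.Realize, sigmaTerm, sigmaMap, Function.Surjective, Fin.snoc,
    Term.realize_functions_apply₁]

theorem real_fun (N : Type u) [(LPlus L2).Structure N] {n : ℕ} (f : L2.Functions n) :
    N ⊨ funCommSentence L2 f ↔ ∀ x : Fin n → N,
      sigmaMap L2 N (funMap (L := LPlus L2) (Sum.inl f) x) =
        funMap (L := LPlus L2) (Sum.inl f) (fun i => sigmaMap L2 N (x i)) := by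
  unfold funCommSentence Sentence.Realize
  rw [BoundedFormula.realize_alls]
  refine forall_congr' fun x => ?_
  rw [BoundedFormula.realize_bdEqual, sigmaTerm, Term.realize_functions_apply₁]
  have : ∀ i, Term.realize (Sum.elim default x)
      (sigmaTerm (L := L2) (Term.var (Sum.inr i) : (LPlus L2).Term (Empty ⊕ Fin n))) =
      sigmaMap L2 N (x i) := fun i => Term.realize_functions_apply₁
  erw [Term.realize_func, Term.realize_func]
  simp only [this]
  rfl

theorem real_rel (N : Type u) [(LPlus L2).Structure N] {n : ℕ} (f : L2.Relations n) :
    N ⊨ relPresSentence L2 f ↔ ∀ x : Fin n → N,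
      (RelMap (L := LPlus L2) (Sum.inl f) x ↔
        RelMap (L := LPlus L2) (Sum.inl f) (fun i => sigmaMap L2 N (x i))) := by
  unfold relPresSentence Sentence.Realize
  rw [BoundedFormula.realize_alls]
  refine forall_congr' fun x => ?_
  have : ∀ i, Term.realize (Sum.elim default x)
      (sigmaTerm (L := L2) (Term.var (Sum.inr i) : (LPlus L2).Term (Empty ⊕ Fin n))) =
      sigmaMap L2 N (x i) := fun i => Term.realize_functions_apply₁
  rw [BoundedFormula.realize_iff]
  erw [BoundedFormula.realize_rel, BoundedFormula.realize_rel]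
  simp only [this]
  rfl

theorem taut_sound (N : Type u) [(LPlus L2).Structure N] (h : N ⊨ Taut T0) :
    Bas (EP N) (QP N) (FP N) ∧ IsAut (EP N) (FP N) (sigmaMap L2 N) := by
  constructor
  · let _ : L2.Structure N := (LHom.sumInl : L2 →ᴸ LPlus L2).reduct N
    have : (LHom.sumInl : L2 →ᴸ LPlus L2).IsExpansionOn N := LHom.isExpansionOn_reduct _ _
    have : N ⊨ T0 := by
      rw [← LHom.onTheory_model (LHom.sumInl : L2 →ᴸ LPlus L2)]
      exact h.mono (fun φ hφ => Or.inl (Or.inl (Or.inl hφ)))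
    exact bas_of_T0 N this
  · refine ⟨⟨?_, ?_⟩, ?_, ?_⟩
    · rw [← real_inj]
      exact h.realize_of_mem _ (by simp [Taut])
    · rw [← real_surj]
      exact h.realize_of_mem _ (by simp [Taut])
    · intro x y
      have := (real_rel N L2Rel.E).1 (h.realize_of_mem _ (Or.inr ⟨_, _, rfl⟩)) ![x, y]
      refine Iff.trans ?_ this.symm
      rw [vec2 (fun i => sigmaMap L2 N (![x, y] i))]; rfl
    · intro i x
      have := (real_fun N (fsym i)).1 (h.realize_of_mem _ (Or.inl (Or.inr ⟨_, _, rfl⟩))) ![x]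
      refine Eq.trans ?_ this.symm
      rw [vec1 (fun i => sigmaMap L2 N (![x] i))]; rfl

theorem taut_of (N : Type u) [(LPlus L2).Structure N] (h : Bas (EP N) (QP N) (FP N))
    (h' : IsAut (EP N) (FP N) (sigmaMap L2 N)) (hG : Gen (EP N) (FP N) (sigmaMap L2 N) 0) :
    N ⊨ Taut T0 := by
  have hT : N ⊨ (LHom.sumInl : L2 →ᴸ LPlus L2).onTheory T0 := by
    let _ : L2.Structure N := (LHom.sumInl : L2 →ᴸ LPlus L2).reduct N
    have : (LHom.sumInl : L2 →ᴸ LPlus L2).IsExpansionOn N := LHom.isExpansionOn_reduct _ _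
    rw [LHom.onTheory_model (LHom.sumInl : L2 →ᴸ LPlus L2)]
    exact model_T0 N h (gen_id hG h.refl)
  refine ⟨?_⟩
  rintro φ (((hφ | (rfl | rfl)) | ⟨n, f, rfl⟩) | ⟨n, r, rfl⟩)
  · exact hT.realize_of_mem _ hφ
  · exact (real_inj N).2 h'.bij.1
  · exact (real_surj N).2 h'.bij.2
  · rw [real_fun]
    intro x
    change L0Func n at f
    cases f
    · rw [vec1 x, vec1 (fun i => sigmaMap L2 N (![x 0] i))]
      exact (h'.sF false (x 0)).symm
    · rw [vec1 x, vec1 (fun i => sigmaMap L2 N (![x 0] i))]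
      exact (h'.sF true (x 0)).symm
  · rw [real_rel]
    intro x
    change L2Rel n at r
    cases r
    · rw [vec1 x, vec1 (fun i => sigmaMap L2 N (![x 0] i))]
      refine (h.Q _).trans (Iff.trans ?_ (h.Q _).symm)
      change _ ↔ FP N false (sigmaMap L2 N (x 0)) = sigmaMap L2 N (x 0)
      rw [h'.sF, h'.bij.1.eq_iff]
    · rw [vec2 x, vec2 (fun i => sigmaMap L2 N (![x 0, x 1] i))]
      exact (h'.sE (x 0) (x 1)).symm

/-- Generic structures. -/
structure Generic (N : Type u) [(LPlus L2).Structure N] : Prop where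
  bas : Bas (EP N) (QP N) (FP N)
  aut : IsAut (EP N) (FP N) (sigmaMap L2 N)
  gen : ∀ n, Gen (EP N) (FP N) (sigmaMap L2 N) n

/-- The model completion. -/
def Tm : (LPlus L2).Theory :=
  {φ | ∀ (N : Type u) [(LPlus L2).Structure N], Generic N → N ⊨ φ}

theorem Generic.model {N : Type u} [(LPlus L2).Structure N] (h : Generic N) : N ⊨ Tm.{u} :=
  ⟨fun _ hφ => hφ N h⟩

theorem taut_sub : Taut T0 ⊆ Tm.{u} := by
  intro φ hφ N _ h
  exact (taut_of N h.bas h.aut (h.gen 0)).realize_of_mem _ hφ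

theorem generic_of_model {N : Type u} [(LPlus L2).Structure N] (h : N ⊨ Tm.{u}) : Generic N := by
  have hT := taut_sound N (h.mono taut_sub)
  refine ⟨hT.1, hT.2, fun n => ⟨?_, ?_, ?_⟩⟩
  · intro r hr hr' k
    obtain ⟨φ, hφ⟩ := exists_sentence (g1_df.{u} (α := Empty) r k)
    exact (hφ N).1 (h.realize_of_mem φ (fun M _ hM => (hφ M).2 ((hM.gen n).g1 r hr hr' k)))
  · intro r hr hr' k e f w
    obtain ⟨φ, hφ⟩ := exists_sentence (g2_df.{u} (α := Empty) n r k e f w)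
    exact (hφ N).1 (h.realize_of_mem φ (fun M _ hM => (hφ M).2 ((hM.gen n).g2 r hr hr' k e f w)))
  · intro k
    obtain ⟨φ, hφ⟩ := exists_sentence (g3_df.{u} (α := Empty) n k)
    exact (hφ N).1 (h.realize_of_mem φ (fun M _ hM => (hφ M).2 ((hM.gen n).g3 k)))


structure SysEmb {M N : Type u} (S₀ : Sys M) (S : Sys N) (f : M → N) : Prop where
  inj : Function.Injective f
  E : ∀ x y, S.E (f x) (f y) ↔ S₀.E x y
  F : ∀ i x, S.F i (f x) = f (S₀.F i x)
  s : ∀ x, S.s (f x) = f (S₀.s x)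

namespace SysEmb
variable {M N N₁ N₂ : Type u} {S₀ : Sys M} {S : Sys N} {S₁ : Sys N₁} {S₂ : Sys N₂} {f : M → N}
  {f₁ : M → N₁} {f₂ : M → N₂}

theorem z (h : SysEmb S₀ S f) (z : ℤ) (x : M) : (S.s ^ z) (f x) = f ((S₀.s ^ z) x) := by
  have hn : ∀ (n : ℕ) x, (S.s ^ n) (f x) = f ((S₀.s ^ n) x) := by
    intro n
    induction n with
    | zero => intro x; simp
    | succ n ih => intro x; simp only [pow_succ', Equiv.Perm.mul_apply, h.s, ih]
  obtain ⟨n, rfl | rfl⟩ := z.eq_nat_or_neg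
  · simpa using hn n x
  · have := hn n ((S₀.s ^ (-(n:ℤ))) x)
    have h2 : (S₀.s ^ n) ((S₀.s ^ (-(n:ℤ))) x) = x := by simp
    rw [h2] at this
    rw [← this]; simp

theorem Q (h : SysEmb S₀ S f) (x : M) : S.Q (f x) ↔ S₀.Q x := by
  rw [Sys.Q, h.F, h.inj.eq_iff, Sys.Q]

theorem P (h : SysEmb S₀ S f) (t : ℤ) (a b : M) : S.P t (f a) (f b) ↔ S₀.P t a b := by
  by_cases hab : S₀.Q a ∧ S₀.Q b ∧ S₀.E a b ∧ a ≠ b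
  · obtain ⟨x, y, -, hx, -, -, rfl, rfl⟩ := S₀.fibx hab.1 hab.2.1 hab.2.2.1 hab.2.2.2
    rw [← h.F, ← h.F, ← S.P_all (by rwa [h.Q]), ← S₀.P_all hx, h.z, h.inj.eq_iff]
  · refine iff_of_false (fun H => hab ?_) (fun H => hab ?_)
    · have := Sys.P_prop H
      rw [h.Q, h.Q, h.E, h.inj.ne_iff] at this
      exact ⟨this.1, this.2.1, this.2.2.1, this.2.2.2.1⟩
    · have := Sys.P_prop H
      exact ⟨this.1, this.2.1, this.2.2.1, this.2.2.2.1⟩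

theorem bf (h₁ : SysEmb S₀ S₁ f₁) (h₂ : SysEmb S₀ S₂ f₂) (K : ℕ) {A : Set M} (hA : A.Finite) :
    ∃ R, BF S₁ S₂ K R ∧ ∀ a ∈ A, (f₁ a, f₂ a) ∈ R := by
  refine ⟨(fun a => (f₁ a, f₂ a)) '' (A ∪ (S₀.F false '' A ∪ S₀.F true '' A)), ⟨?_, ?_, ?_⟩, ?_⟩
  · exact (hA.union ((hA.image _).union (hA.image _))).image _
  · rintro _ ⟨a, ha, rfl⟩ i
    refine ⟨S₀.F i a, ?_, by simp [h₁.F, h₂.F]⟩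
    rcases ha with ha | (⟨a, ha, rfl⟩ | ⟨a, ha, rfl⟩)
    · right
      cases i
      · exact Or.inl ⟨a, ha, rfl⟩
      · exact Or.inr ⟨a, ha, rfl⟩
    · rw [S₀.FF]
      exact Or.inr (Or.inl ⟨a, ha, rfl⟩)
    · rw [S₀.FF]
      exact Or.inr (Or.inr ⟨a, ha, rfl⟩)
  · rintro _ ⟨a, -, rfl⟩ _ ⟨b, -, rfl⟩ z hz
    simp only [h₁.z, h₂.z, h₁.E, h₂.E, h₁.P, h₂.P, h₁.inj.eq_iff, h₂.inj.eq_iff]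
    simp
  · intro a ha
    exact ⟨a, Or.inl ha, rfl⟩

end SysEmb

theorem atomic_equivSentence {L : Language.{0, 0}} {M : Type u} {φ : L.Formula M} (h : φ.IsAtomic) :
    (Formula.equivSentence φ).IsAtomic := by
  cases h with
  | equal t₁ t₂ => exact BoundedFormula.IsAtomic.equal _ _
  | rel R ts => exact BoundedFormula.IsAtomic.rel _ _

theorem diagram_iff {L : Language.{0, 0}} {M N : Type u} [L.Structure M] [(L[[M]]).Structure N]
    (h : N ⊨ atomicDiagram L M) (φ : L.Formula M) (hφ : φ.IsAtomic) :
    (let _ : L.Structure N := (L.lhomWithConstants M).reduct N;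
      φ.Realize (fun m => ((L.con m : (L[[M]]).Constants) : N)) ↔ φ.Realize (fun m : M => m)) := by
  intro _
  have : (L.lhomWithConstants M).IsExpansionOn N := LHom.isExpansionOn_reduct _ _
  have h1 := Formula.realize_equivSentence N φ
  have h2 := Formula.realize_equivSentence M φ
  have h3 : (fun m : M => ((L.con m : (L[[M]]).Constants) : M)) = fun m => m := by
    funext m; rfl
  rw [h3] at h2
  rw [← h1, ← h2]
  have ha := atomic_equivSentence hφ
  constructor
  · intro hN
    by_contra hM
    have := h.realize_of_mem (∼(Formula.equivSentence φ)) ⟨Or.inr ⟨_, ha, rfl⟩, hM⟩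
    exact this hN
  · intro hM
    exact h.realize_of_mem (Formula.equivSentence φ) ⟨Or.inl ha, hM⟩

theorem complete_aux {M : Type u} [(LPlus L2).Structure M] (hM : M ⊨ Taut T0)
    {N : Type u} [((LPlus L2)[[M]]).Structure N]
    (hN : N ⊨ ((LPlus L2).lhomWithConstants M).onTheory Tm.{u} ∪ atomicDiagram (LPlus L2) M) :
    (let _ : (LPlus L2).Structure N := ((LPlus L2).lhomWithConstants M).reduct N;
     ∃ h : Generic N, SysEmb (sysP M (taut_sound M hM).1 (taut_sound M hM).2) (sysP N h.bas h.aut)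
       (fun m => (((LPlus L2).con m : ((LPlus L2)[[M]]).Constants) : N))) := by
  intro _
  have : ((LPlus L2).lhomWithConstants M).IsExpansionOn N := LHom.isExpansionOn_reduct _ _
  have h1 : N ⊨ Tm.{u} := by
    rw [← LHom.onTheory_model ((LPlus L2).lhomWithConstants M)]
    exact hN.mono Set.subset_union_left
  have hD : N ⊨ atomicDiagram (LPlus L2) M := hN.mono Set.subset_union_right
  have D := fun φ hφ => diagram_iff hD φ hφ
  have D' : ∀ φ : (LPlus L2).Formula M, φ.IsAtomic →
      (φ.Realize (fun m => (((LPlus L2).con m : ((LPlus L2)[[M]]).Constants) : N)) ↔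
        φ.Realize (fun m : M => m)) := D
  have hf : ∀ (f : (LPlus L2).Functions 1) (x : M),
      funMap f ![(((LPlus L2).con x : ((LPlus L2)[[M]]).Constants) : N)] =
        (((LPlus L2).con (funMap f ![x]) : ((LPlus L2)[[M]]).Constants) : N) := by
    intro f x
    have := (D ((f.apply₁ (Term.var x)).equal (Term.var (funMap f ![x])))
      (BoundedFormula.IsAtomic.equal _ _)).2 (by simp [Formula.realize_equal, Term.realize_functions_apply₁])
    rw [Formula.realize_equal, Term.realize_functions_apply₁] at this
    exact this
  have hr : ∀ (r : (LPlus L2).Relations 2) (x y : M),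
      RelMap r ![(((LPlus L2).con x : ((LPlus L2)[[M]]).Constants) : N),
        (((LPlus L2).con y : ((LPlus L2)[[M]]).Constants) : N)] ↔ RelMap r ![x, y] := by
    intro r x y
    have := D' (r.formula₂ (Term.var x) (Term.var y)) (BoundedFormula.IsAtomic.rel _ _)
    rw [Formula.realize_rel₂, Formula.realize_rel₂] at this
    exact this
  refine ⟨generic_of_model h1, ?_, ?_, ?_, ?_⟩
  · intro x y hxy
    have := (D ((Term.var x).equal (Term.var y)) (BoundedFormula.IsAtomic.equal _ _)).1
      (by rw [Formula.realize_equal]; exact hxy)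
    rw [Formula.realize_equal] at this
    exact this
  · intro x y
    exact hr (Sum.inl L2Rel.E) x y
  · intro i x
    exact hf (Sum.inl (fsym i)) x
  · intro x
    exact hf (sigmaSymb L2) x

theorem complete_part {M : Type u} [(LPlus L2).Structure M] (hM : M ⊨ Taut T0)
    (φ : ((LPlus L2)[[M]]).Sentence) :
    (((LPlus L2).lhomWithConstants M).onTheory Tm.{u} ∪ atomicDiagram (LPlus L2) M) ⊨ᵇ φ ∨
    (((LPlus L2).lhomWithConstants M).onTheory Tm.{u} ∪ atomicDiagram (LPlus L2) M) ⊨ᵇ ∼φ := by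
  rw [Theory.models_sentence_iff, Theory.models_sentence_iff]
  by_contra! hcon
  obtain ⟨⟨N₁, h₁⟩, ⟨N₂, h₂⟩⟩ := hcon
  obtain ⟨G₁, e₁⟩ := complete_aux hM N₁.is_model
  obtain ⟨G₂, e₂⟩ := complete_aux hM N₂.is_model
  let _ : (LPlus L2).Structure N₁ := ((LPlus L2).lhomWithConstants M).reduct N₁
  let _ : (LPlus L2).Structure N₂ := ((LPlus L2).lhomWithConstants M).reduct N₂
  have : ((LPlus L2).lhomWithConstants M).IsExpansionOn N₁ := LHom.isExpansionOn_reduct _ _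
  have : ((LPlus L2).lhomWithConstants M).IsExpansionOn N₂ := LHom.isExpansionOn_reduct _ _
  obtain ⟨K, A, hA, H⟩ := ef (interpP N₁ G₁.bas G₁.aut) (interpP N₂ G₂.bas G₂.aut)
    (ext_of_gen G₂.gen) (ext_of_gen G₁.gen) (Formula.equivSentence.symm φ)
  obtain ⟨R, hR, hAR⟩ := e₁.bf e₂ K hA
  have key := H _ _ default default R hR hAR (fun i => i.elim0)
  have k1 := Formula.realize_equivSentence_symm_con N₁ φ
  have k2 := Formula.realize_equivSentence_symm_con N₂ φ
  have k3 : N₁ ⊨ φ ↔ N₂ ⊨ φ :=  k1.symm.trans (key.trans k2)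
  rw [Sentence.realize_not, not_not] at h₂
  exact h₁ (k3.2 h₂)


theorem Generic.pick {N : Type u} [(LPlus L2).Structure N] (h : Generic N) {x : N}
    (hx : EP N (sigmaMap L2 N x) x) (A : Finset N) (p q : N → Prop)
    (hA : ∀ a ∈ A, FP N false a = a ∧ EP N a x ∧ sigmaMap L2 N a = a) :
    ∃ d, (FP N false d = d ∧ EP N d x ∧ sigmaMap L2 N d = d) ∧
      ∀ a ∈ A, (PN (FP N) (sigmaMap L2 N) 1 d a ↔ p a) ∧ (PN (FP N) (sigmaMap L2 N) 1 a d ↔ q a) := by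
  let e := A.equivFin.symm
  obtain ⟨d, h1, h2, h3, -, -, h4, -⟩ := (h.gen 1).g2 1 one_pos le_rfl A.card (fun i => p (e i)) (fun i => q (e i))
    (fun _ => True) x (fun i => (e i : N)) hx (by
      intro i j r hr hij
      have hfix : (sigmaMap L2 N)^[1 * r] (e i : N) = (e i : N) :=
        Function.iterate_fixed (hA _ (e i).2).2.2 _
      rw [← hij, hfix]
      exact ⟨Iff.rfl, Iff.rfl⟩)
  refine ⟨d, ⟨h1, h2, h3⟩, fun a ha => ?_⟩
  obtain ⟨i, hi⟩ := e.surjective ⟨a, ha⟩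
  have hi' : (e i : N) = a := by rw [hi]
  have := h4 i (by rw [hi']; exact (hA a ha).1) (by rw [hi']; exact (hA a ha).2.1) 1 le_rfl one_pos
    (by rw [hi']; exact (hA a ha).2.2) (by intros; omega)
  rw [hi'] at this
  exact this

theorem Generic.order {N : Type u} [(LPlus L2).Structure N] (h : Generic N) :
    ∃ f : ℕ → N × N, ∀ i j, PN (FP N) (sigmaMap L2 N) 1 (f i).1 (f j).2 ↔ i < j := by
  classical
  obtain ⟨x, hx, -, -⟩ := (h.gen 1).g1 1 one_pos (by omega) 0 Fin.elim0
  let p : N → Prop := fun a => FP N false a = a ∧ EP N a x ∧ sigmaMap L2 N a = a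
  obtain ⟨f, hf1, hf2⟩ := exists_seq_of_forall_finset_exists (α := N × N)
    (fun a => p a.1 ∧ p a.2 ∧ ¬ PN (FP N) (sigmaMap L2 N) 1 a.1 a.2)
    (fun a b => PN (FP N) (sigmaMap L2 N) 1 a.1 b.2 ∧ ¬ PN (FP N) (sigmaMap L2 N) 1 b.1 a.2) (by
    intro s hs
    obtain ⟨b, hb, hb'⟩ := h.pick hx (s.image Prod.fst) (fun _ => True) (fun _ => True) (by
      intro a ha
      obtain ⟨c, hc, rfl⟩ := Finset.mem_image.1 ha
      exact (hs c hc).1)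
    obtain ⟨a, ha, ha'⟩ := h.pick hx (insert b (s.image Prod.snd)) (fun _ => False) (fun _ => False) (by
      intro a ha
      rcases Finset.mem_insert.1 ha with rfl | ha
      · exact hb
      obtain ⟨c, hc, rfl⟩ := Finset.mem_image.1 ha
      exact (hs c hc).2.1)
    refine ⟨(a, b), ⟨ha, hb, ?_⟩, ?_⟩
    · exact (ha' b (Finset.mem_insert_self _ _)).1.1
    · intro c hc
      refine ⟨(hb' c.1 (Finset.mem_image_of_mem _ hc)).2.2 trivial, ?_⟩
      exact (ha' c.2 (Finset.mem_insert_of_mem (Finset.mem_image_of_mem _ hc))).1.1)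
  refine ⟨f, fun i j => ⟨fun hij => ?_, fun hij => (hf2 i j hij).1⟩⟩
  by_contra hlt
  rcases (not_lt.1 hlt).eq_or_lt with rfl | hji
  · exact (hf1 _).2.2 hij
  · exact (hf2 j i hji).2 hij

theorem unstable_part (Tstar : (LPlus L2).Theory) (h : IsCompletionOf Tm.{u} Tstar) :
    ¬ IsStableTheory.{0, 0, u} Tstar := by
  intro hs
  apply hs
  obtain ⟨N0⟩ := h.2.1
  let N : Theory.ModelType.{0, 0, u} Tstar := Theory.ModelType.ulift.{0, 0, 0, u} N0
  have hN : N ⊨ Tm.{u} := N.is_model.mono h.1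
  obtain ⟨f, hf⟩ := (generic_of_model hN).order
  obtain ⟨φ, hφ⟩ := Df.PN.{u} (α := Fin 1 ⊕ Fin 1) 1 (Dt.var (Sum.inl 0)) (Dt.var (Sum.inr 0))
  refine ⟨1, 1, φ, N, fun i _ => (f i).1, fun i _ => (f i).2, fun i j => ?_⟩
  rw [hφ, ← hf]
  rfl


/-- Data describing a system: points of `Q`, their classes, and a cocycle. -/
structure Pre (D X : Type u) where
  cls : D → X
  τ : Equiv.Perm X
  σ : Equiv.Perm D
  hcls : ∀ a, cls (σ a) = τ (cls a)
  ε : D → D → ZMod 2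
  hε : ∀ a, ε a a = 0

namespace Pre
variable {D X : Type u} (P : Pre D X)

@[ext]
structure Nt where
  a : D
  b : D
  l : ZMod 2
  h : P.cls a = P.cls b
  h' : a = b → l = 0

variable {P} in
def pt (a : D) : P.Nt := ⟨a, a, 0, rfl, fun _ => rfl⟩

def Fn (i : Bool) (x : P.Nt) : P.Nt := pt (cond i x.b x.a)

def sn : Equiv.Perm P.Nt where
  toFun x := ⟨P.σ x.a, P.σ x.b, x.l + P.ε x.a x.b, by rw [P.hcls, P.hcls, x.h], fun h => by
    have := P.σ.injective h
    rw [x.h' this, this, P.hε, add_zero]⟩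
  invFun x := ⟨P.σ.symm x.a, P.σ.symm x.b, x.l - P.ε (P.σ.symm x.a) (P.σ.symm x.b), by
    apply P.τ.injective
    rw [← P.hcls, ← P.hcls]; simpa using x.h, fun h => by
    rw [h, P.hε, sub_zero]; exact x.h' (P.σ.symm.injective h)⟩
  left_inv x := by ext <;> simp
  right_inv x := by ext <;> simp

theorem Fn_eq (x : P.Nt) : P.Fn false x = x ↔ x.a = x.b := by
  constructor
  · intro h
    have := congrArg Nt.b h
    simpa [Fn, pt] using this
  · intro h
    ext
    · rfl
    · exact h
    · exact (x.h' h).symm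

theorem pt_inj {a b : D} : (pt a : P.Nt) = pt b ↔ a = b := by
  constructor
  · intro h; exact congrArg Nt.a h
  · rintro rfl; rfl

theorem eq_pt {x : P.Nt} (h : P.Fn false x = x) : x = pt x.a := h.symm

theorem z2 {a b c : ZMod 2} (h : a ≠ b) : c = a ∨ c = b := by
  revert a b c; decide

def sys : Sys P.Nt where
  E x y := P.cls x.a = P.cls y.a
  F := P.Fn
  s := P.sn
  refl _ := rfl
  symm h := h.symm
  trans h h' := h.trans h'
  FE i x := by cases i
               · rfl
               · exact x.h.symm
  FF i j x := by cases i <;> rfl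
  Finj x h := by
    rw [Fn_eq]
    exact congrArg Nt.a h
  fib a b ha hb hE hab := by
    rw [eq_pt P ha, eq_pt P hb, Ne, pt_inj] at hab
    rw [eq_pt P ha, eq_pt P hb]
    refine ⟨⟨a.a, b.a, 0, hE, fun h => (hab h).elim⟩, ⟨a.a, b.a, 1, hE, fun h => (hab h).elim⟩, ?_,
      rfl, rfl, rfl, rfl, ?_⟩
    · intro h
      have := congrArg Nt.l h
      simp at this
    · intro z h1 h2
      have h1' := congrArg Nt.a h1
      have h2' := congrArg Nt.a h2
      rcases z2 (a := 0) (b := 1) (c := z.l) (by decide) with h | h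
      · left; ext
        exacts [h1', h2', h]
      · right; ext
        exacts [h1', h2', h]
  sE {x y} := by
    change P.cls (P.σ x.a) = P.cls (P.σ y.a) ↔ _
    rw [P.hcls, P.hcls, P.τ.injective.eq_iff]
  sF i x := by
    cases i
    · ext
      · rfl
      · rfl
      · change 0 = 0 + P.ε _ _
        rw [zero_add]; exact (P.hε _).symm
    · ext
      · rfl
      · rfl
      · change 0 = 0 + P.ε _ _
        rw [zero_add]; exact (P.hε _).symm

/-- Accumulated cocycle. -/
def acc (t : ℕ) (a b : D) : ZMod 2 := ∑ s ∈ Finset.range t, P.ε ((P.σ ^ s) a) ((P.σ ^ s) b)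

theorem iter (t : ℕ) (x : P.Nt) : (P.sn^[t] x).a = (P.σ ^ t) x.a ∧ (P.sn^[t] x).b = (P.σ ^ t) x.b ∧
    (P.sn^[t] x).l = x.l + P.acc t x.a x.b := by
  induction t with
  | zero => simp [acc]
  | succ t ih =>
    rw [Function.iterate_succ_apply']
    obtain ⟨h1, h2, h3⟩ := ih
    refine ⟨?_, ?_, ?_⟩
    · change P.σ _ = _
      rw [h1, pow_succ']; rfl
    · change P.σ _ = _
      rw [h2, pow_succ']; rfl
    · change _ + P.ε _ _ = _
      rw [h3, h1, h2, acc, acc, Finset.sum_range_succ, add_assoc]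

theorem iter_pt (t : ℕ) (a : D) : P.sn^[t] (pt a) = pt ((P.σ ^ t) a) := by
  obtain ⟨h1, h2, h3⟩ := P.iter t (pt a)
  ext
  · exact h1
  · exact h2
  · rw [h3]
    simp [pt, acc, P.hε]

theorem PN_iff (t : ℕ) (a b : D) : PN P.Fn P.sn t (pt a) (pt b) ↔
    a ≠ b ∧ P.cls a = P.cls b ∧ (P.σ ^ t) a = a ∧ (P.σ ^ t) b = b ∧ P.acc t a b = 0 := by
  constructor
  · rintro ⟨x, h1, h2, h3, h4⟩
    have h2' : x.a = a := congrArg Nt.a h2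
    have h3' : x.b = b := congrArg Nt.a h3
    obtain ⟨k1, k2, k3⟩ := P.iter t x
    rw [h4] at k1 k2 k3
    rw [Ne, Fn_eq] at h1
    subst h2' h3'
    refine ⟨h1, x.h, k1.symm, k2.symm, ?_⟩
    simpa using k3
  · rintro ⟨h1, h2, h3, h4, h5⟩
    refine ⟨⟨a, b, 0, h2, fun h => (h1 h).elim⟩, ?_, rfl, rfl, ?_⟩
    · rw [Ne, Fn_eq]; exact h1
    · obtain ⟨k1, k2, k3⟩ := P.iter t ⟨a, b, 0, h2, fun h => (h1 h).elim⟩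
      ext
      · rw [k1]; exact h3
      · rw [k2]; exact h4
      · rw [k3]; simp [h5]

/-- The point-level genericity. -/
structure DGen : Prop where
  g1 : ∀ r, 0 < r → ∀ (A : Set D), A.Finite → ∃ d, P.cls ((P.σ ^ r) d) = P.cls d ∧
    (∀ i < r, 0 < i → P.cls ((P.σ ^ i) d) ≠ P.cls d) ∧ ∀ a ∈ A, P.cls d ≠ P.cls a
  g2 : ∀ r, 0 < r → ∀ (A : Set D), A.Finite → ∀ (p q : D → Prop) (w : ℕ → Prop) (c : D),
    P.cls ((P.σ ^ r) c) = P.cls c →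
    ∃ d, P.cls d = P.cls c ∧ (P.σ ^ r) d = d ∧ (∀ i < r, 0 < i → (P.σ ^ i) d ≠ d) ∧ d ∉ A ∧
      (∀ a ∈ A, P.cls a = P.cls c → ∀ t, 0 < t → (P.σ ^ (r * t)) a = a →
        (∀ t' < t, 0 < t' → (P.σ ^ (r * t')) a ≠ a) →
        (∀ t' < t, (P.σ ^ (r * t')) a ∈ A → (p a ↔ p ((P.σ ^ (r * t')) a)) ∧ (q a ↔ q ((P.σ ^ (r * t')) a))) →
        (P.acc (r * t) d a = 0 ↔ p a) ∧ (P.acc (r * t) a d = 0 ↔ q a)) ∧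
      ∀ j < r, 0 < j → (P.acc r d ((P.σ ^ j) d) = 0 ↔ w j)
  g3 : ∀ (A : Set D), A.Finite → ∀ c, ∃ d, P.cls d = P.cls c ∧ (∀ i, 0 < i → (P.σ ^ i) d ≠ d) ∧ d ∉ A

theorem cls_it (t : ℕ) (x y : P.Nt) : P.sys.E (P.sn^[t] x) y ↔ P.cls ((P.σ ^ t) x.a) = P.cls y.a := by
  change P.cls _ = _ ↔ _
  rw [(P.iter t x).1]

theorem gen_of (H : P.DGen) (n : ℕ) : Gen P.sys.E P.sys.F P.sys.s n where
  g1 r hr _ k v := by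
    obtain ⟨d, h1, h2, h3⟩ := H.g1 r hr (Set.range fun i => (v i).a) (Set.finite_range _)
    refine ⟨pt d, ?_, ?_, ?_⟩
    · exact (P.cls_it _ _ _).2 h1
    · intro i hi hi' h
      exact h2 i hi hi' ((P.cls_it _ _ _).1 h)
    · intro i h
      exact h3 _ ⟨i, rfl⟩ h
  g3 k x v := by
    obtain ⟨d, h1, h2, h3⟩ := H.g3 (Set.range fun i => (v i).a) (Set.finite_range _) x.a
    refine ⟨pt d, rfl, h1, ?_, ?_⟩
    · intro i _ hi h
      refine h2 i hi ?_
      rw [← P.pt_inj, ← P.iter_pt]; exact h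
    · intro i h
      exact h3 ⟨i, by simp [← h, pt]⟩
  g2 r hr hrn k e f w x v hx hv := by
    let A : Set D := {a | ∃ i, v i = pt a}
    have hA : A.Finite := by
      refine (Set.finite_range fun i => (v i).a).subset ?_
      rintro a ⟨i, hi⟩
      exact ⟨i, by simp [hi, pt]⟩
    obtain ⟨d, h1, h2, h3, h4, h5, h6⟩ := H.g2 r hr A hA (fun a => ∃ i, v i = pt a ∧ e i)
      (fun a => ∃ i, v i = pt a ∧ f i) w x.a ((P.cls_it _ _ _).1 hx)
    have hw : ∀ i, (∃ j, v j = v i ∧ e j) ↔ e i := fun i =>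
      ⟨fun ⟨j, h, h'⟩ => (hv j i 0 (Nat.zero_le _) h).1.1 h', fun h => ⟨i, rfl, h⟩⟩
    have hw' : ∀ i, (∃ j, v j = v i ∧ f j) ↔ f i := fun i =>
      ⟨fun ⟨j, h, h'⟩ => (hv j i 0 (Nat.zero_le _) h).2.1 h', fun h => ⟨i, rfl, h⟩⟩
    refine ⟨pt d, rfl, h1, ?_, ?_, ?_, ?_, ?_⟩
    · change P.sn^[r] _ = _
      rw [iter_pt, h2]
    · intro i hi hi'
      change P.sn^[i] _ ≠ _
      rw [iter_pt, Ne, pt_inj]; exact h3 i hi hi'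
    · intro i h
      exact h4 ⟨i, h.symm⟩
    · intro i hQ hE t ht ht0 hfix hmin
      have hpt : v i = pt (v i).a := eq_pt P hQ
      set a := (v i).a with ha
      have haA : a ∈ A := ⟨i, hpt⟩
      change P.cls (v i).a = P.cls x.a at hE
      rw [← ha] at hE
      have hit : ∀ s, P.sys.s^[s] (v i) = pt ((P.σ ^ s) a) := by
        intro s
        rw [hpt]; exact P.iter_pt _ _
      have hfix' : (P.σ ^ (r * t)) a = a := by
        rw [hit, hpt, pt_inj] at hfix; exact hfix
      have := h5 a haA hE t ht0 hfix' (by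
        intro t' h7 h8
        have := hmin t' h7 h8
        rw [hit, hpt, Ne, pt_inj] at this; exact this) (by
        rintro t' h7 ⟨j, hj⟩
        rw [← hpt, ← hj, hw, hw, hw', hw']
        exact hv i j t' (by omega) (by rw [hit, hj]))
      rw [hpt]
      change (PN P.Fn P.sn _ _ _ ↔ _) ∧ (PN P.Fn P.sn _ _ _ ↔ _)
      have hne : d ≠ a := fun h => h4 (h ▸ haA)
      have hd : (P.σ ^ (r * t)) d = d := by
        rw [pow_mul]
        exact Function.IsFixedPt.perm_pow (e := P.σ ^ r) h2 t
      rw [PN_iff, PN_iff, this.1, this.2, ← hpt, hw, hw']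
      simp [hne, hne.symm, h1, hE, hfix', hd]
    · intro j hj hj0 hE
      change PN P.Fn P.sn _ _ (P.sn^[j] _) ↔ _
      have hE' := (P.cls_it _ _ _).1 hE
      rw [iter_pt, PN_iff, h6 j hj hj0]
      have : (P.σ ^ r) ((P.σ ^ j) d) = (P.σ ^ j) d := by
        rw [← Equiv.Perm.mul_apply, ← pow_add, add_comm, pow_add, Equiv.Perm.mul_apply, h2]
      have h7 : P.cls d = P.cls ((P.σ ^ j) d) := hE'.symm
      simp [this, h2, ← h7, (h3 j hj hj0).symm]

end Pre


section Con
variable {M : Type u} (S : Sys M)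

def clsSetoid : Setoid M := ⟨S.E, S.refl, S.symm, S.trans⟩

/-- The classes of the generic extension. -/
abbrev Xt := Quotient (clsSetoid S) ⊕ (Σ r : ℕ, ℕ × ZMod (r + 1))

def tauC : Equiv.Perm (Quotient (clsSetoid S)) :=
  Quotient.congr S.s (fun _ _ => S.sE.symm)

def tauN : Equiv.Perm (Σ r : ℕ, ℕ × ZMod (r + 1)) :=
  Equiv.sigmaCongrRight fun r => Equiv.prodCongr (Equiv.refl ℕ) (Equiv.addRight (1 : ZMod (r + 1)))

def tauX : Equiv.Perm (Xt S) := Equiv.sumCongr (tauC S) tauN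

/-- The `Q`-points of the generic extension. -/
inductive Pt : Type u
  | old (a : M) (h : S.Q a) : Pt
  | new (x : Xt S) (r : ℕ) (j : ZMod r) (k : ℕ) (f : Fin k → Pt) (e g : Fin k → Prop) (w : ℕ → Prop) : Pt

namespace Pt
variable {S}

def dep : Pt S → ℕ
  | old _ _ => 0
  | new _ _ _ _ f _ _ _ => (Finset.univ.sup fun i => dep (f i)) + 1

theorem dep_lt {x : Xt S} {r : ℕ} {j : ZMod r} {k : ℕ} (f : Fin k → Pt S) (e g : Fin k → Prop) (w : ℕ → Prop)
    (i : Fin k) : dep (f i) < dep (new x r j k f e g w) := by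
  rw [dep]
  exact Nat.lt_succ_of_le (Finset.le_sup (f := fun i => dep (f i)) (Finset.mem_univ i))

def sg : Equiv.Perm (Pt S) where
  toFun
    | old a h => old (S.s a) (by rw [Sys.Q, S.sF, h])
    | new x r j k f e g w => new (tauX S x) r (j + 1) k f e g w
  invFun
    | old a h => old (S.s.symm a) (by
        rw [Sys.Q]; apply S.s.injective; rw [← S.sF]; simpa [Sys.Q] using h)
    | new x r j k f e g w => new ((tauX S).symm x) r (j - 1) k f e g w
  left_inv a := by cases a <;> simp
  right_inv a := by cases a <;> simp

def cl : Pt S → Xt S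
  | old a _ => Sum.inl (Quotient.mk _ a)
  | new x _ _ _ _ _ _ _ => x

theorem sg_new (t : ℕ) (x : Xt S) (r : ℕ) (j : ZMod r) (k : ℕ) (f : Fin k → Pt S) (e g : Fin k → Prop) (w : ℕ → Prop) :
    (sg ^ t) (new x r j k f e g w) = new ((tauX S ^ t) x) r (j + t) k f e g w := by
  induction t with
  | zero => simp
  | succ t ih =>
    rw [pow_succ', Equiv.Perm.mul_apply, ih]
    change new _ _ _ _ _ _ _ _ = _
    rw [pow_succ', Equiv.Perm.mul_apply]
    push_cast
    rw [add_assoc]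

theorem dep_sg (a : Pt S) : dep (sg a) = dep a := by
  cases a <;> rfl

theorem dep_sgn (t : ℕ) (a : Pt S) : dep ((sg ^ t) a) = dep a := by
  induction t with
  | zero => simp
  | succ t ih => rw [pow_succ', Equiv.Perm.mul_apply, dep_sg, ih]

def XX : Pt S → Pt S → Prop
  | old _ _, _ => False
  | a@(new _ r j _ f e _ w), b => j = 0 ∧ ((∃ i, f i = b ∧ e i) ∨ ∃ m, 0 < m ∧ m < r ∧ b = (sg ^ m) a ∧ w m)

def YY : Pt S → Pt S → Prop
  | old _ _, _ => False
  | new _ _ j _ f _ g _, b => j = 0 ∧ ∃ i, f i = b ∧ g i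

theorem XX_dep {a b : Pt S} (h : XX a b) : dep b ≤ dep a := by
  cases a with
  | old => exact h.elim
  | new x r j k f e g w =>
    obtain ⟨-, ⟨i, rfl, -⟩ | ⟨m, -, -, rfl, -⟩⟩ := h
    · exact (dep_lt _ _ _ _ _).le
    · rw [dep_sgn]

theorem YY_dep {a b : Pt S} (h : YY a b) : dep b < dep a := by
  cases a with
  | old => exact h.elim
  | new x r j k f e g w =>
    obtain ⟨-, i, rfl, -⟩ := h
    exact (dep_lt _ _ _ _ _)

/-- The old part of the cocycle. -/
def OO (o : M → M → Prop) : Pt S → Pt S → Prop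
  | old a _, old b _ => o a b
  | _, _ => False

open Classical in
noncomputable def ep (o : M → M → Prop) (a b : Pt S) : ZMod 2 :=
  if a ≠ b ∧ (OO o a b ∨ XX a b ∨ YY b a) then 1 else 0

noncomputable def pre (o : M → M → Prop) : Pre (Pt S) (Xt S) where
  cls := cl
  τ := tauX S
  σ := sg
  hcls a := by cases a <;> rfl
  ε := ep o
  hε a := by simp [ep]

variable (o : M → M → Prop)

theorem cl_sgn (t : ℕ) (a : Pt S) : cl ((sg ^ t) a) = (tauX S ^ t) (cl a) := by
  induction t with
  | zero => simp
  | succ t ih =>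
    rw [pow_succ', Equiv.Perm.mul_apply, pow_succ', Equiv.Perm.mul_apply, ← ih]
    exact (pre (fun _ _ => True)).hcls _

theorem tau_new (t : ℕ) (r m : ℕ) (j : ZMod (r + 1)) : (tauX S ^ t) (Sum.inr ⟨r, m, j⟩) = Sum.inr ⟨r, m, j + t⟩ := by
  induction t with
  | zero => simp
  | succ t ih =>
    rw [pow_succ', Equiv.Perm.mul_apply, ih]
    change Sum.inr _ = _
    push_cast
    rw [← add_assoc]; rfl

theorem gg1 (r : ℕ) (hr : 0 < r) (A : Set (Pt S)) (hA : A.Finite) :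
    ∃ d : Pt S, cl ((sg ^ r) d) = cl d ∧
    (∀ i < r, 0 < i → cl ((sg ^ i) d) ≠ cl d) ∧ ∀ a ∈ A, cl d ≠ cl a := by
  obtain ⟨r, rfl⟩ : ∃ r', r = r' + 1 := ⟨r - 1, by omega⟩
  have hinj : Function.Injective (fun m : ℕ => (Sum.inr ⟨r, m, 0⟩ : Xt S)) := by
    intro m m' h
    simpa using h
  obtain ⟨m, hm⟩ : ∃ m : ℕ, (Sum.inr ⟨r, m, 0⟩ : Xt S) ∉ cl '' A := by
    by_contra! h
    exact Set.infinite_univ (((hA.image cl).preimage hinj.injOn).subset fun m _ => h m)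
  refine ⟨new (Sum.inr ⟨r, m, 0⟩) 0 0 0 Fin.elim0 Fin.elim0 Fin.elim0 (fun _ => True), ?_, ?_, ?_⟩
  · rw [sg_new]
    change (tauX S ^ (r + 1)) _ = Sum.inr _
    rw [tau_new]
    simp
  · intro i hi hi0
    rw [sg_new]
    change (tauX S ^ i) _ ≠ Sum.inr _
    rw [tau_new]
    intro h
    simp at h
    rw [ZMod.natCast_eq_zero_iff] at h
    exact absurd (Nat.le_of_dvd hi0 h) (by omega)
  · intro a ha h
    exact hm ⟨a, ha, h.symm⟩

theorem gg3 (A : Set (Pt S)) (hA : A.Finite) (c : Pt S) :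
    ∃ d : Pt S, cl d = cl c ∧ (∀ i, 0 < i → (sg ^ i) d ≠ d) ∧ d ∉ A := by
  obtain ⟨k, f, -, rfl⟩ := hA.fin_param
  refine ⟨new (cl c) 0 0 k f (fun _ => True) (fun _ => True) (fun _ => True), rfl, ?_, ?_⟩
  · intro i hi h
    rw [sg_new] at h
    injection h with _ _ h
    try simp only [heq_eq_eq] at h
    rw [zero_add, ZMod.natCast_eq_zero_iff] at h
    simp at h
    omega
  · rintro ⟨i, hi⟩
    have := dep_lt (x := cl c) (r := 0) (j := 0) f (fun _ => True) (fun _ => True) (fun _ => True) i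
    rw [hi] at this
    exact lt_irrefl _ this

theorem mark {α : Type u} (ρ : Equiv.Perm α) (A : Set α) : ∃ C : α → Prop, ∀ a ∈ A, ∀ t, 0 < t → (ρ ^ t) a = a →
    (∀ t' < t, 0 < t' → (ρ ^ t') a ≠ a) →
    ∃ m < t, (ρ ^ m) a ∈ A ∧ C ((ρ ^ m) a) ∧ ∀ m' < t, C ((ρ ^ m') a) → m' = m := by
  classical
  let c' : α → α := fun b => @Classical.epsilon α ⟨b⟩ (fun z => z ∈ A ∧ ρ.SameCycle b z)
  have hc : ∀ b m, c' ((ρ ^ m) b) = c' b := by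
    intro b m
    simp only [c', Equiv.Perm.sameCycle_pow_left]
  refine ⟨fun b => c' b = b, fun a ha t ht hta hmin => ?_⟩
  have hsp : c' a ∈ A ∧ ρ.SameCycle a (c' a) :=
    @Classical.epsilon_spec_aux α ⟨a⟩ (fun z => z ∈ A ∧ ρ.SameCycle a z) ⟨a, ha, Equiv.Perm.SameCycle.refl _ _⟩
  obtain ⟨hcA, n, hn⟩ := hsp
  have hz : ∀ j : ℤ, ((ρ ^ t) ^ j) a = a := fun j => Equiv.Perm.zpow_apply_eq_self_of_apply_eq_self hta j
  have hpos : (0 : ℤ) < t := by exact_mod_cast ht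
  have hmod : (ρ ^ (n % t).toNat) a = c' a := by
    rw [← hn]
    conv_rhs => rw [← Int.emod_add_mul_ediv n t]
    rw [zpow_add, Equiv.Perm.mul_apply, zpow_mul, zpow_natCast, hz, ← zpow_natCast,
      Int.toNat_of_nonneg (Int.emod_nonneg _ hpos.ne')]
  have hlt : (n % t).toNat < t := by
    have := Int.emod_lt_of_pos n hpos
    omega
  refine ⟨(n % t).toNat, hlt, hmod ▸ hcA, ?_, ?_⟩
  · change c' _ = _
    rw [hc, hmod]
  · intro m' hm' h
    change c' _ = _ at h
    rw [hc, ← hmod] at h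
    have key : ∀ m n : ℕ, m < n → n < t → (ρ ^ m) a = (ρ ^ n) a → False := by
      intro m n hmn hn h
      obtain ⟨d, rfl⟩ := Nat.exists_eq_add_of_lt hmn
      rw [add_assoc, pow_add, Equiv.Perm.mul_apply] at h
      exact hmin (d + 1) (by omega) (by omega) ((ρ ^ m).injective h).symm
    rcases lt_trichotomy m' (n % t).toNat with h1 | h1 | h1
    · exact (key _ _ h1 hlt h.symm).elim
    · exact h1
    · exact (key _ _ h1 hm' h).elim

open Classical in
theorem mark_sum {α : Type u} (σ : Equiv.Perm α) (A : Set α) (C : α → Prop) (r t : ℕ) (hr : 0 < r) (a : α) (p : α → Prop)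
    (hm : ∃ m < t, ((σ ^ r) ^ m) a ∈ A ∧ C (((σ ^ r) ^ m) a) ∧ ∀ m' < t, C (((σ ^ r) ^ m') a) → m' = m)
    (hp : ∀ t' < t, (σ ^ (r * t')) a ∈ A → (p a ↔ p ((σ ^ (r * t')) a))) :
    (∑ s ∈ Finset.range (r * t), if r ∣ s ∧ ((σ ^ s) a ∈ A ∧ ¬ p ((σ ^ s) a) ∧ C ((σ ^ s) a)) then (1 : ZMod 2) else 0) = 0
      ↔ p a := by
  obtain ⟨m, hmt, hA, hC, hu⟩ := hm
  simp only [← pow_mul] at hA hC hu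
  by_cases h : p a
  · simp only [h, iff_true]
    apply Finset.sum_eq_zero
    intro s hs
    rw [if_neg]
    rintro ⟨⟨m', rfl⟩, h1, h2, h3⟩
    have hm' : m' < t := by
      rw [Finset.mem_range] at hs
      exact lt_of_mul_lt_mul_left hs (Nat.zero_le _)
    exact h2 ((hp m' hm' h1).1 h)
  · simp only [h, iff_false]
    rw [Finset.sum_eq_single (r * m)]
    · rw [if_pos]
      · decide
      · exact ⟨⟨m, rfl⟩, hA, fun h' => h ((hp m hmt hA).2 h'), hC⟩
    · intro s hs hne
      rw [if_neg]
      rintro ⟨⟨m', rfl⟩, h1, h2, h3⟩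
      have hm' : m' < t := by
        rw [Finset.mem_range] at hs
        exact lt_of_mul_lt_mul_left hs (Nat.zero_le _)
      exact hne (by rw [hu m' hm' h3])
    · intro hn
      exact (hn (Finset.mem_range.2 (Nat.mul_lt_mul_of_pos_left hmt hr))).elim

section
variable (x : Xt S) (r : ℕ) (k : ℕ) (f : Fin k → Pt S) (e g : Fin k → Prop) (w : ℕ → Prop)

open Classical in
theorem ep1 (b : Pt S) (hb : dep b < dep (new x r 0 k f e g w)) (s : ℕ) :
    ep o ((sg ^ s) (new x r 0 k f e g w)) ((sg ^ s) b) =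
      if r ∣ s ∧ ∃ i, f i = (sg ^ s) b ∧ e i then 1 else 0 := by
  unfold ep
  congr 1
  apply propext
  have hne : (sg ^ s) (new x r 0 k f e g w) ≠ (sg ^ s) b := by
    intro h; rw [(sg ^ s).injective h] at hb; exact lt_irrefl _ hb
  have hY : ¬ YY ((sg ^ s) b) ((sg ^ s) (new x r 0 k f e g w)) := by
    intro h
    have := YY_dep h
    rw [dep_sgn, dep_sgn] at this
    omega
  simp only [hne, hY, ne_eq, not_false_eq_true, true_and, or_false]
  have hXX : XX ((sg ^ s) (new x r 0 k f e g w)) ((sg ^ s) b) ↔ r ∣ s ∧ ∃ i, f i = (sg ^ s) b ∧ e i := by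
    rw [← ZMod.natCast_eq_zero_iff, sg_new, zero_add]
    constructor
    · rintro ⟨h, h' | ⟨m, -, -, h', -⟩⟩
      · exact ⟨h, h'⟩
      · have := congrArg dep h'
        rw [dep_sgn, dep_sgn] at this
        rw [this] at hb
        exact absurd hb (lt_irrefl _)
    · rintro ⟨h, h'⟩
      exact ⟨h, Or.inl h'⟩
  have hO : ¬ OO o ((sg ^ s) (new x r 0 k f e g w)) ((sg ^ s) b) := by
    rw [sg_new]
    exact fun h => h.elim
  rw [hXX]
  simp only [hO, false_or]

open Classical in
theorem ep2 (b : Pt S) (hb : dep b < dep (new x r 0 k f e g w)) (s : ℕ) :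
    ep o ((sg ^ s) b) ((sg ^ s) (new x r 0 k f e g w)) =
      if r ∣ s ∧ ∃ i, f i = (sg ^ s) b ∧ g i then 1 else 0 := by
  unfold ep
  congr 1
  apply propext
  have hne : (sg ^ s) b ≠ (sg ^ s) (new x r 0 k f e g w) := by
    intro h; rw [(sg ^ s).injective h] at hb; exact lt_irrefl _ hb
  have hX : ¬ XX ((sg ^ s) b) ((sg ^ s) (new x r 0 k f e g w)) := by
    intro h
    have := XX_dep h
    rw [dep_sgn, dep_sgn] at this
    omega
  simp only [hne, hX, ne_eq, not_false_eq_true, true_and, false_or]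
  have hXX : YY ((sg ^ s) (new x r 0 k f e g w)) ((sg ^ s) b) ↔ r ∣ s ∧ ∃ i, f i = (sg ^ s) b ∧ g i := by
    rw [← ZMod.natCast_eq_zero_iff, sg_new, zero_add]
    exact Iff.rfl
  have hO : ¬ OO o ((sg ^ s) b) ((sg ^ s) (new x r 0 k f e g w)) := by
    rw [sg_new]
    cases (sg ^ s) b <;> exact fun h => h.elim
  rw [hXX]
  simp only [hO, false_or]

theorem per (hr : 0 < r) (i : ℕ) (hi : 0 < i) (hir : i < r) : (sg ^ i) (new x r 0 k f e g w) ≠ new x r 0 k f e g w := by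
  intro h
  rw [sg_new] at h
  injection h with _ _ h
  try simp only [heq_eq_eq] at h
  rw [zero_add, ZMod.natCast_eq_zero_iff] at h
  exact absurd (Nat.le_of_dvd hi h) (by omega)

theorem per' (hr : 0 < r) (i j : ℕ) (hi : i < r) (hj : j < r)
    (h : (sg ^ i) (new x r 0 k f e g w) = (sg ^ j) (new x r 0 k f e g w)) : i = j := by
  have key : ∀ m n : ℕ, m < n → n < r → (sg ^ m) (new x r 0 k f e g w) = (sg ^ n) (new x r 0 k f e g w) → False := by
    intro m n hmn hn h
    obtain ⟨d, rfl⟩ := Nat.exists_eq_add_of_lt hmn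
    rw [add_assoc, pow_add, Equiv.Perm.mul_apply] at h
    exact per x r k f e g w hr (d + 1) (by omega) (by omega) ((sg ^ m).injective h).symm
  rcases lt_trichotomy i j with h1 | h1 | h1
  · exact (key _ _ h1 hj h).elim
  · exact h1
  · exact (key _ _ h1 hi h.symm).elim

open Classical in
theorem ep3 (hr : 0 < r) (j : ℕ) (hj : 0 < j) (hjr : j < r) (s : ℕ) :
    ep o ((sg ^ s) (new x r 0 k f e g w)) ((sg ^ s) ((sg ^ j) (new x r 0 k f e g w))) =
      if r ∣ s ∧ w j then 1 else 0 := by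
  unfold ep
  congr 1
  apply propext
  have hne : (sg ^ s) (new x r 0 k f e g w) ≠ (sg ^ s) ((sg ^ j) (new x r 0 k f e g w)) := by
    intro h
    exact per x r k f e g w hr j hj hjr ((sg ^ s).injective h).symm
  have hY : ¬ YY ((sg ^ s) ((sg ^ j) (new x r 0 k f e g w))) ((sg ^ s) (new x r 0 k f e g w)) := by
    intro h
    have := YY_dep h
    rw [dep_sgn, dep_sgn, dep_sgn] at this
    omega
  simp only [hne, hY, ne_eq, not_false_eq_true, true_and, or_false]
  have hXX : XX ((sg ^ s) (new x r 0 k f e g w)) ((sg ^ s) ((sg ^ j) (new x r 0 k f e g w))) ↔ r ∣ s ∧ w j := by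
    rw [← ZMod.natCast_eq_zero_iff]
    constructor
    · intro h
      have h0 := h
      rw [sg_new, zero_add] at h
      obtain ⟨h, ⟨i, h', -⟩ | ⟨m, hm0, hmr, h', hw⟩⟩ := h
      · have := dep_lt (x := x) (r := r) (j := 0) f e g w i
        rw [h', dep_sgn, dep_sgn] at this
        exact absurd this (lt_irrefl _)
      · refine ⟨h, ?_⟩
        have h2 : new ((tauX S ^ s) x) r (s : ZMod r) k f e g w = (sg ^ s) (new x r 0 k f e g w) := by
          rw [sg_new, zero_add]
        rw [h2, ← Equiv.Perm.mul_apply, ← Equiv.Perm.mul_apply, ← pow_add, ← pow_add, add_comm m s, pow_add, pow_add,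
          Equiv.Perm.mul_apply, Equiv.Perm.mul_apply] at h'
        rwa [per' x r k f e g w hr j m hjr hmr ((sg ^ s).injective h')]
    · rintro ⟨h, h'⟩
      rw [← Equiv.Perm.mul_apply, ← pow_add, add_comm s j, pow_add, Equiv.Perm.mul_apply]
      rw [sg_new, zero_add]
      exact ⟨h, Or.inr ⟨j, hj, hjr, rfl, h'⟩⟩
  have hO : ¬ OO o ((sg ^ s) (new x r 0 k f e g w)) ((sg ^ s) ((sg ^ j) (new x r 0 k f e g w))) := by
    rw [sg_new]
    exact fun h => h.elim
  rw [hXX]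
  simp only [hO, false_or]
end

theorem dgen : (pre o : Pre (Pt S) (Xt S)).DGen where
  g1 := gg1
  g3 := gg3
  g2 := by
    classical
    intro r hr A hA p q w c hc
    obtain ⟨C, hC⟩ := mark ((sg : Equiv.Perm (Pt S)) ^ r) A
    obtain ⟨k, f, -, hf⟩ := hA.fin_param
    have hfA : ∀ b (Z : Pt S → Prop), (∃ i, f i = b ∧ Z (f i)) ↔ (b ∈ A ∧ Z b) := by
      intro b Z
      rw [← hf]
      constructor
      · rintro ⟨i, rfl, h⟩; exact ⟨⟨i, rfl⟩, h⟩
      · rintro ⟨⟨i, rfl⟩, h⟩; exact ⟨i, rfl, h⟩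
    have hdl : ∀ a ∈ A, dep a < dep (new (cl c) r 0 k f (fun i => ¬ p (f i) ∧ C (f i)) (fun i => ¬ q (f i) ∧ C (f i))
        (fun m => ¬ w m)) := by
      intro a ha
      rw [← hf] at ha
      obtain ⟨i, rfl⟩ := ha
      exact dep_lt _ _ _ _ _
    refine ⟨new (cl c) r 0 k f (fun i => ¬ p (f i) ∧ C (f i)) (fun i => ¬ q (f i) ∧ C (f i)) (fun m => ¬ w m),
      rfl, ?_, ?_, ?_, ?_, ?_⟩
    · change (sg ^ r) _ = _
      rw [sg_new]
      have : (tauX S ^ r) (cl c) = cl c := by rw [← cl_sgn]; exact hc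
      rw [this]; simp
    · intro i hi hi0
      exact per _ _ _ _ _ _ _ hr i hi0 hi
    · intro h
      exact lt_irrefl _ (hdl _ h)
    · intro a ha _ t ht hta hmin hpq
      have hm := hC a ha t ht (by rw [← pow_mul]; exact hta) (by
        intro t' h1 h2; rw [← pow_mul]; exact hmin t' h1 h2)
      constructor
      · rw [← mark_sum sg A C r t hr a p hm (fun t' h1 h2 => (hpq t' h1 h2).1)]
        unfold Pre.acc
        rw [Finset.sum_congr rfl]
        intro s _
        refine (ep1 o _ _ _ _ _ _ _ a (hdl a ha) s).trans ?_
        congr 1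
        rw [hfA ((sg ^ s) a) (fun b => ¬ p b ∧ C b)]
      · rw [← mark_sum sg A C r t hr a q hm (fun t' h1 h2 => (hpq t' h1 h2).2)]
        unfold Pre.acc
        rw [Finset.sum_congr rfl]
        intro s _
        refine (ep2 o _ _ _ _ _ _ _ a (hdl a ha) s).trans ?_
        congr 1
        rw [hfA ((sg ^ s) a) (fun b => ¬ q b ∧ C b)]
    · intro j hjr hj
      unfold Pre.acc
      have h3 := Finset.sum_congr (rfl : Finset.range r = Finset.range r) (fun s _ => ep3 o (cl c) r k f
        (fun i => ¬ p (f i) ∧ C (f i)) (fun i => ¬ q (f i) ∧ C (f i)) (fun m => ¬ w m) hr j hj hjr s)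
      refine (Eq.congr_left h3).trans ?_
      rw [Finset.sum_eq_single 0]
      · by_cases h : w j <;> simp [h]
      · intro s hs h0
        rw [if_neg]
        rintro ⟨h, -⟩
        exact absurd (Nat.le_of_dvd (Nat.pos_of_ne_zero h0) h) (by
          rw [Finset.mem_range] at hs; omega)
      · intro h; exact (h (Finset.mem_range.2 hr)).elim

end Pt
end Con

section Emb
variable {M : Type u} (S : Sys M)

open Classical in
/-- A section of the two-to-one map onto pairs. -/
noncomputable def sec (a b : M) : M :=
  if h : ∃ x, ¬ S.Q x ∧ S.F false x = a ∧ S.F true x = b then h.choose else a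

theorem sec_spec {x : M} (hx : ¬ S.Q x) : ¬ S.Q (sec S (S.F false x) (S.F true x)) ∧
    ∀ i, S.F i (sec S (S.F false x) (S.F true x)) = S.F i x := by
  have h : ∃ y, ¬ S.Q y ∧ S.F false y = S.F false x ∧ S.F true y = S.F true x := ⟨x, hx, rfl, rfl⟩
  rw [sec, dif_pos h]
  refine ⟨h.choose_spec.1, fun i => ?_⟩
  cases i
  · exact h.choose_spec.2.1
  · exact h.choose_spec.2.2

def oo (a b : M) : Prop := S.s (sec S a b) ≠ sec S (S.s a) (S.s b)

open Classical in
noncomputable def lab (x : M) : ZMod 2 := if S.Q x ∨ x = sec S (S.F false x) (S.F true x) then 0 else 1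

theorem lab_zero {x : M} (hx : ¬ S.Q x) : lab S x = 0 ↔ x = sec S (S.F false x) (S.F true x) := by
  rw [lab]; split_ifs with h
  · simpa [hx] using h
  · simp; tauto

theorem Q_s {x : M} : S.Q (S.s x) ↔ S.Q x := by
  rw [Sys.Q, S.sF, S.s.injective.eq_iff, Sys.Q]

noncomputable abbrev gsys : Sys (Pt.pre (S := S) (oo S)).Nt := (Pt.pre (S := S) (oo S)).sys

noncomputable def emb (x : M) : (Pt.pre (S := S) (oo S)).Nt where
  a := .old (S.F false x) (S.QF _ _)
  b := .old (S.F true x) (S.QF _ _)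
  l := lab S x
  h := congrArg Sum.inl (Quotient.sound (S.trans (S.FE _ _) (S.symm (S.FE _ _))))
  h' h := by
    injection h with h
    rw [lab, if_pos (Or.inl (show S.Q x from S.Finj x h))]

theorem ep_old (a b : M) (ha : S.Q a) (hb : S.Q b) (hab : a ≠ b) :
    (Pt.ep (oo S) (.old a ha) (.old b hb) : ZMod 2) = 0 ↔ ¬ oo S a b := by
  classical
  have hne : Pt.old a ha ≠ Pt.old b hb := by
    intro h; injection h with h; exact hab h
  have h1 : ¬ Pt.XX (Pt.old a ha) (Pt.old b hb) := fun h => h.elim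
  have h2 : ¬ Pt.YY (Pt.old b hb) (Pt.old a ha) := fun h => h.elim
  have h3 : Pt.OO (oo S) (Pt.old a ha) (Pt.old b hb) ↔ oo S a b := Iff.rfl
  unfold Pt.ep
  by_cases h : oo S a b
  · rw [if_pos ⟨hne, Or.inl (h3.2 h)⟩]
    simp [h]
  · rw [if_neg (by rw [h3]; tauto)]
    simp [h]

theorem lab_s (x : M) : lab S x + Pt.ep (oo S) (.old (S.F false x) (S.QF _ _)) (.old (S.F true x) (S.QF _ _)) =
    lab S (S.s x) := by
  classical
  by_cases hx : S.Q x
  · have h0 : lab S x = 0 := by rw [lab, if_pos (Or.inl hx)]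
    have h1 : lab S (S.s x) = 0 := by rw [lab, if_pos (Or.inl ((Q_s S).2 hx))]
    have : ∀ (a b : M) (ha : S.Q a) (hb : S.Q b), a = b → Pt.ep (oo S) (.old a ha) (.old b hb) = 0 := by
      rintro a b ha hb rfl
      simp [Pt.ep]
    rw [h0, h1, zero_add, this]
    rw [hx.F, hx.F]
  · have hsx : ¬ S.Q (S.s x) := fun h => hx ((Q_s S).1 h)
    obtain ⟨hz, hzF⟩ := sec_spec S hx
    obtain ⟨hz', hzF'⟩ := sec_spec S hsx
    have hep := ep_old S (S.F false x) (S.F true x) (S.QF _ _) (S.QF _ _) (fun h => hx (S.Finj x h))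
    rw [oo, ← S.sF, ← S.sF] at hep
    have hl1 : lab S x = 0 ↔ x = sec S (S.F false x) (S.F true x) := by
      rw [lab]; split_ifs with h
      · simpa [hx] using h
      · simp; tauto
    have hl2 : lab S (S.s x) = 0 ↔ S.s x = sec S (S.F false (S.s x)) (S.F true (S.s x)) := by
      rw [lab]; split_ifs with h
      · simpa [hsx] using h
      · simp; tauto
    generalize sec S (S.F false x) (S.F true x) = z at *
    generalize sec S (S.F false (S.s x)) (S.F true (S.s x)) = z' at *
    generalize lab S x = l at *
    generalize lab S (S.s x) = l' at *
    generalize Pt.ep (oo S) _ _ = e at *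
    have z2 : ∀ l l' e : ZMod 2, ((l' = 0) ↔ ((l = 0) ↔ (e = 0))) → l + e = l' := by decide
    apply z2
    rw [hl1, hl2, hep, not_ne_iff]
    by_cases h1 : x = z
    · subst h1; simp
    · by_cases h2 : S.s z = z'
      · subst h2; simp
      · simp only [h1, h2, iff_self, iff_true]
        refine S.fib2 (x := S.s z) (fun h => hz ((Q_s S).1 h)) ?_ ?_ ?_ ?_
        · intro i; rw [S.sF, S.sF, hzF]
        · intro i; rw [hzF', S.sF, S.sF, hzF]
        · exact fun h => h1 (S.s.injective h)
        · exact fun h => h2 h.symm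

theorem emb_emb : SysEmb S (gsys S) (emb S) where
  inj x y h := by
    have h0 : S.F false x = S.F false y := by
      have := congrArg Pre.Nt.a h
      injection this
    have h1 : S.F true x = S.F true y := by
      have := congrArg Pre.Nt.b h
      injection this
    have hl : lab S x = lab S y := congrArg Pre.Nt.l h
    by_cases hx : S.Q x
    · have hy : S.Q y := S.Finj y (by rw [← h0, ← h1, hx.F, hx.F])
      rw [← hx.F false, ← hy.F false, h0]
    · have hy : ¬ S.Q y := fun hy => hx (S.Finj x (by rw [h0, h1, hy.F, hy.F]))
      obtain ⟨hz, hzF⟩ := sec_spec S hx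
      obtain ⟨-, hzF'⟩ := sec_spec S hy
      have k1 := lab_zero S hx
      have k2 := lab_zero S hy
      rw [← h0, ← h1] at k2 hzF'
      by_cases e1 : x = sec S (S.F false x) (S.F true x)
      · exact e1.trans (k2.1 (hl ▸ k1.2 e1)).symm
      · have e2 : y ≠ sec S (S.F false x) (S.F true x) := fun e2 => e1 (k1.1 (hl ▸ k2.2 e2))
        exact S.fib2 hz (fun i => (hzF i).symm) (fun i => (hzF' i).symm) e1 e2
  E x y := by
    change Sum.inl _ = Sum.inl _ ↔ _
    rw [Sum.inl.injEq]
    refine Quotient.eq.trans ?_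
    exact S.congr (S.FE _ _) (S.FE _ _)
  F i x := by
    have hl : lab S (S.F i x) = 0 := by rw [lab, if_pos (Or.inl (S.QF _ _))]
    have e1 : ∀ j, S.F j (S.F i x) = S.F i x := fun j => S.FF _ _ _
    ext
    · change cond i _ _ = Pt.old (S.F false (S.F i x)) _
      simp only [e1]
      cases i <;> rfl
    · change cond i _ _ = Pt.old (S.F true (S.F i x)) _
      simp only [e1]
      cases i <;> rfl
    · exact hl.symm
  s x := by
    ext
    · change Pt.old (S.s (S.F false x)) _ = Pt.old (S.F false (S.s x)) _
      simp only [S.sF]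
    · change Pt.old (S.s (S.F true x)) _ = Pt.old (S.F true (S.s x)) _
      simp only [S.sF]
    · exact lab_s S x

theorem gsys_gen (n : ℕ) : Gen (gsys S).E (gsys S).F (gsys S).s n := Pre.gen_of _ (Pt.dgen _) n
end Emb

/-- The structure associated with a system. -/
abbrev strOf {N : Type u} (S : Sys N) : (LPlus L2).Structure N where
  funMap {n} f x :=
    match n, f, x with
    | _, Sum.inl L0Func.F₁, x => S.F false (x 0)
    | _, Sum.inl L0Func.F₂, x => S.F true (x 0)
    | _, Sum.inr SigmaFunc.sigma, x => S.s (x 0)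
  RelMap {n} r x :=
    match n, r, x with
    | _, Sum.inl L2Rel.Q, x => S.Q (x 0)
    | _, Sum.inl L2Rel.E, x => S.E (x 0) (x 1)

theorem strOf_generic {N : Type u} (S : Sys N) (h : ∀ n, Gen S.E S.F S.s n) :
    @Generic N (strOf S) := by
  let := strOf S
  have hE : EP N = S.E := rfl
  have hQ : QP N = S.Q := rfl
  have hF : FP N = S.F := by
    funext i x; cases i <;> rfl
  have hs : sigmaMap L2 N = S.s := rfl
  refine ⟨?_, ?_, ?_⟩
  · rw [hE, hQ, hF]
    exact ⟨S.refl, fun _ _ => S.symm, fun _ _ _ => S.trans, S.FE, S.FF, S.Finj, S.fib, fun _ => Iff.rfl⟩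
  · rw [hE, hF, hs]
    exact ⟨S.s.bijective, fun _ _ => S.sE, S.sF⟩
  · rw [hE, hF, hs]
    exact h

theorem exists_ext {M : Type u} [(LPlus L2).Structure M] (hM : M ⊨ Taut T0) :
    ∃ (N : Type u) (_ : (LPlus L2).Structure N), N ⊨ Tm.{u} ∧ Nonempty (M ↪[LPlus L2] N) := by
  obtain ⟨hB, hA⟩ := taut_sound M hM
  let S := sysP M hB hA
  let := strOf (gsys S)
  have he := emb_emb S
  refine ⟨_, this, (strOf_generic (gsys S) (gsys_gen S)).model, ⟨⟨⟨emb S, he.inj⟩, ?_, ?_⟩⟩⟩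
  · intro n f x
    change L0Func n ⊕ SigmaFunc n at f
    rcases f with f | f
    · cases f
      · rw [vec1 x]; exact (he.F false (x 0)).symm
      · rw [vec1 x]; exact (he.F true (x 0)).symm
    · cases f
      rw [vec1 x]; exact (he.s (x 0)).symm
  · intro n r x
    change L2Rel n ⊕ Empty at r
    rcases r with r | r
    · cases r
      · rw [vec1 x]
        exact (he.Q (x 0)).trans (hB.Q (x 0)).symm
      · rw [vec2 x]
        exact he.E (x 0) (x 1)
    · exact r.elim

theorem sat_part {M : Type u} [(LPlus L2).Structure M] [Nonempty M] (hM : M ⊨ Taut T0) :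
    (((LPlus L2).lhomWithConstants M).onTheory Tm.{u} ∪ atomicDiagram (LPlus L2) M).IsSatisfiable := by
  obtain ⟨N, _, hN, ⟨f⟩⟩ := exists_ext hM
  let : (constantsOn M).Structure N := constantsOn.structure f
  have : Nonempty N := Nonempty.map f inferInstance
  let F : M ↪[(LPlus L2)[[M]]] N :=
    { toEmbedding := f.toEmbedding
      map_fun' := by
        intro n g x
        rcases g with g | g
        · exact f.map_fun g x
        · cases n with
          | zero => rfl
          | succ n => exact (isEmptyElim (α := (constantsOn M).Functions (n+1)) g)
      map_rel' := by
        intro n r x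
        rcases r with r | r
        · exact f.map_rel r x
        · exact (isEmptyElim (α := (constantsOn M).Relations n) r) }
  have key : ∀ φ : ((LPlus L2)[[M]]).Sentence, φ.IsAtomic → (N ⊨ φ ↔ M ⊨ φ) := by
    intro φ hφ
    have := hφ.isQF.realize_embedding F (v := default) (xs := default)
    rw [Subsingleton.elim (F ∘ default) default, Subsingleton.elim (F ∘ default) default] at this
    exact this
  have h2 : N ⊨ ((LPlus L2).lhomWithConstants M).onTheory Tm.{u} ∪ atomicDiagram (LPlus L2) M := by
    refine Theory.model_union_iff.2 ⟨(LHom.onTheory_model _ _).2 hN, ⟨?_⟩⟩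
    rintro φ ⟨h | ⟨ψ, h, rfl⟩, hφ⟩
    · exact (key φ h).2 hφ
    · rw [Sentence.realize_not] at hφ ⊢
      rwa [key ψ h]
  exact Theory.Model.isSatisfiable N

theorem main_part :
    ∃ Tmc : (LPlus L2).Theory,
      IsModelCompletion.{0, 0, u} (Taut (L2.completeTheory MPoint)) Tmc ∧
      ∀ Tstar : (LPlus L2).Theory, IsCompletionOf Tmc Tstar →
        ¬ IsStableTheory.{0, 0, u} Tstar := by
  refine ⟨Tm.{u}, ⟨taut_sub, fun M => ?_, fun M => ⟨sat_part M.is_model, complete_part M.is_model⟩⟩, unstable_part⟩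
  obtain ⟨N, _, hN, ⟨f⟩⟩ := exists_ext (M := M) M.is_model
  have : Nonempty N := Nonempty.map f inferInstance
  exact ⟨⟨N⟩, ⟨f⟩⟩


theorem reduct_modelCompletion_every_completion_unstable :
    ∃ Tmc : (LPlus L2).Theory,
      IsModelCompletion.{0, 0, u} (Taut (L2.completeTheory MPoint)) Tmc ∧
      ∀ Tstar : (LPlus L2).Theory, IsCompletionOf Tmc Tstar →
        ¬ IsStableTheory.{0, 0, u} Tstar := by
  exact main_part.{u}

end ShelahE34

end FirstOrder
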